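/- arXiv:1308.5853 — 4 statements merged into one kernel-verified Lean document; each statement's English description precedes it below -/
import Mathlib

section
/- Let a countable group G act on a set X, let Φ = (ℓ, φ, 𝒵, Γ, ℋ) be a chart for G, let R ⊆ X be (Φ, ε)-roughly A at x ∈ X^ℋ with ε < 1/2, and let M be a positive integer satisfying (M+2)·A + 4·𝒵 ⊆ dom(φ). Let y ∈ X^ℋ. (i) If y = φ(𝐮)·x with 𝐮 ∈ M·A, then R is (Φ, 2ε)-roughly A − 𝐮 at y. (ii) If x = φ(𝐯)·y with −𝐯 ∈ M·A, then R is (Φ, 2ε)-roughly A + 𝐯 at y. -/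
open Pointwise

/-- Points of `ℤ^ℓ × Γ`. -/
abbrev Vec (ℓ : ℕ) (Γ : Type*) := (Fin ℓ → ℤ) × Γ

/-- A rectangle in `ℤ^ℓ × Γ`, recorded by its integer center and its radius vector.
The `Γ`-coordinate of points is unrestricted. -/
structure Rect (ℓ : ℕ) where
  center : Fin ℓ → ℤ
  radius : Fin ℓ → ℕ

namespace Rect

variable {ℓ : ℕ}

/-- The set of points of `ℤ^ℓ × Γ` belonging to the rectangle. -/
def carrier (A : Rect ℓ) (Γ : Type*) : Set (Vec ℓ Γ) :=
  {b | ∀ i, |b.1 i - A.center i| ≤ (A.radius i : ℤ)}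

/-- A rectangle is centered if its center is the origin. -/
def IsCentered (A : Rect ℓ) : Prop := A.center = 0

/-- `A ⊑ B` : a translate of `A` is contained in `B`, i.e. `L_i(A) ≤ L_i(B)` for all `i`. -/
def le (A B : Rect ℓ) : Prop := ∀ i, A.radius i ≤ B.radius i

/-- `λ · A` : the rectangle with the same center and `L_i(λ·A) = ⌊λ L_i(A)⌋`. -/
noncomputable def smul (lam : ℝ) (A : Rect ℓ) : Rect ℓ :=
  ⟨A.center, fun i => (⌊lam * (A.radius i : ℝ)⌋).toNat⟩

/-- `A + 𝐯`, the translate of `A` by `𝐯` (only the `ℤ^ℓ` part of `𝐯` matters). -/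
def translate {Γ : Type*} (A : Rect ℓ) (v : Vec ℓ Γ) : Rect ℓ :=
  ⟨fun i => A.center i + v.1 i, A.radius⟩

/-- `Aⁱ` : `A` flattened in the `i`-th direction. -/
def face (A : Rect ℓ) (i : Fin ℓ) : Rect ℓ :=
  ⟨A.center, Function.update A.radius i 0⟩

/-- `Aⁱ + sign·L_i(A)·𝐞_i`, the face of `A` perpendicular to `𝐞_i` in direction `sign`. -/
def faceRect (A : Rect ℓ) (i : Fin ℓ) (sign : ℤ) : Rect ℓ :=
  ⟨Function.update A.center i (A.center i + sign * (A.radius i : ℤ)),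
   Function.update A.radius i 0⟩

end Rect

/-- The conjugate subgroup `g H g⁻¹`. -/
def conjSubgroup {G : Type*} [Group G] (g : G) (H : Subgroup G) : Subgroup G :=
  Subgroup.map (MulAut.conj g).toMonoidHom H

/-- A chart `Φ = (ℓ, φ, 𝒵, Γ, ℋ)` for a group `G`. -/
structure Chart (G : Type*) [Group G] (ℓ : ℕ) (Γ : Type*) [AddCommGroup Γ] where
  /-- the finite collection `ℋ` of pairwise conjugate subgroups of `G` -/
  H : Finset (Subgroup G)
  /-- the centered rectangle `𝒵` -/
  Z : Rect ℓ
  /-- the domain of `φ`, a centered rectangle -/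
  D : Rect ℓ
  /-- the map `φ` (only its values on `D.carrier Γ` are relevant) -/
  φ : Vec ℓ Γ → G
  Γ_finite : Finite Γ
  H_conj : ∀ H₁ ∈ H, ∀ H₂ ∈ H, ∃ g : G, conjSubgroup g H₁ = H₂
  Z_centered : Z.IsCentered
  Z_pos : ∀ i, 0 < Z.radius i
  D_centered : D.IsCentered
  D_large : (Rect.smul 3 Z).le D
  φ_injOn : Set.InjOn φ (D.carrier Γ)
  φ_zero : φ 0 = 1
  coset_inj : ∀ r ∈ D.carrier Γ, ∀ s ∈ D.carrier Γ, ∀ H₀ ∈ H,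
    (φ s)⁻¹ * φ r ∈ H₀ → r = s
  mul_mem : ∀ r ∈ D.carrier Γ, ∀ s ∈ D.carrier Γ, ∀ H₀ ∈ H,
    ((fun z => r + s + z) '' Z.carrier Γ ⊆ D.carrier Γ) →
    ∃ z ∈ Z.carrier Γ, (φ (r + s + z))⁻¹ * (φ r * φ s) ∈ H₀
  mul_inv_mem : ∀ r ∈ D.carrier Γ, ∀ s ∈ D.carrier Γ, ∀ H₀ ∈ H,
    ((fun z => r - s + z) '' Z.carrier Γ ⊆ D.carrier Γ) →
    ∃ z ∈ Z.carrier Γ, (φ (r - s + z))⁻¹ * (φ r * (φ s)⁻¹) ∈ H₀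
  inv_mul_mem : ∀ r ∈ D.carrier Γ, ∀ s ∈ D.carrier Γ, ∀ H₀ ∈ H,
    ((fun z => -r + s + z) '' Z.carrier Γ ⊆ D.carrier Γ) →
    ∃ z ∈ Z.carrier Γ, (φ (-r + s + z))⁻¹ * ((φ r)⁻¹ * φ s) ∈ H₀
  inv_mem : ∀ s ∈ D.carrier Γ, ∀ H₀ ∈ H,
    ((fun z => -s + z) '' Z.carrier Γ ⊆ D.carrier Γ) →
    ∃ z ∈ Z.carrier Γ, (φ (-s + z))⁻¹ * (φ s)⁻¹ ∈ H₀

section ChartAction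

variable {G : Type*} [Group G] {ℓ : ℕ} {Γ : Type*} [AddCommGroup Γ]

/-- `X^ℋ = {x ∈ X : Stab(x) ∈ ℋ}`. -/
def XH (Φ : Chart G ℓ Γ) (X : Type*) [MulAction G X] : Set X :=
  {x | MulAction.stabilizer G x ∈ Φ.H}

variable {X : Type*} [MulAction G X]

/-- `φ(S)·x`. -/
def chartImg (Φ : Chart G ℓ Γ) (S : Set (Vec ℓ Γ)) (x : X) : Set X :=
  (fun v => Φ.φ v • x) '' S

/-- `φ(S)·T` for a set `T ⊆ X`. -/
def chartImgSet (Φ : Chart G ℓ Γ) (S : Set (Vec ℓ Γ)) (T : Set X) : Set X :=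
  ⋃ y ∈ T, chartImg Φ S y

/-- `R` is `(Φ, ε)`-roughly `A` at `x`. -/
def RoughlyAt (Φ : Chart G ℓ Γ) (A : Rect ℓ) (ε : ℝ) (R : Set X) (x : X) : Prop :=
  0 < ε ∧ ε < 1 ∧ x ∈ XH Φ X ∧
  (Rect.smul 2 A).carrier Γ ⊆ Φ.D.carrier Γ ∧
  (Rect.smul 2 Φ.Z).le (Rect.smul ε A) ∧
  chartImg Φ ((Rect.smul (1 - ε) A).carrier Γ) x ⊆ R ∧
  R ⊆ chartImg Φ ((Rect.smul (1 + ε) A).carrier Γ) x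

/-- `R` is `(Φ, ε)`-roughly `A` (at some base point of `X^ℋ`). -/
def Roughly (Φ : Chart G ℓ Γ) (A : Rect ℓ) (ε : ℝ) (R : Set X) : Prop :=
  ∃ x : X, RoughlyAt Φ A ε R x

/-- The class `[x]_E`. -/
def eqClass {X : Type*} (E : X → X → Prop) (x : X) : Set X := {y | E x y}

/-- `E` is `(Φ, A, ε)`-rectangular. -/
def IsRectangular (Φ : Chart G ℓ Γ) (A : Rect ℓ) (ε : ℝ) (E : X → X → Prop) : Prop :=
  A.IsCentered ∧ 0 < ε ∧ ε < 1 ∧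
  (∀ x : X, ¬ (∃ y ∈ eqClass E x, y ∈ XH Φ X) → eqClass E x = {x}) ∧
  (∀ x : X, (∃ y ∈ eqClass E x, y ∈ XH Φ X) →
    ∃ (δ : ℝ) (B : Rect ℓ), 0 < δ ∧ Roughly Φ B δ (eqClass E x) ∧
      A.le B ∧ (Rect.smul ((2 : ℝ) ^ (22 * ℓ)) B).carrier Γ ⊆ Φ.D.carrier Γ ∧
      (Rect.smul (2 * δ) B).le (Rect.smul ε A))

/-- `E` is `(Φ, A, ε)`-sub-rectangular. -/
def IsSubRectangular (Φ : Chart G ℓ Γ) (A : Rect ℓ) (ε : ℝ) (E : X → X → Prop) : Prop :=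
  ∃ F : X → X → Prop, Equivalence F ∧ (∀ x y, F x y → E x y) ∧ IsRectangular Φ A ε F

/-- The `E`-saturation of a set. -/
def eSat {X : Type*} (E : X → X → Prop) (S : Set X) : Set X := {y | ∃ s ∈ S, E s y}

/-- The `(Φ, i, A)`-boundary `∂_i^Φ(E, A)`. -/
def bdry (Φ : Chart G ℓ Γ) (E : X → X → Prop) (A : Rect ℓ) (i : Fin ℓ) : Set X :=
  {x | x ∈ XH Φ X ∧
    Disjoint (eSat E (chartImg Φ ((A.faceRect i (-1)).carrier Γ) x))
             (eSat E (chartImg Φ ((A.faceRect i 1).carrier Γ) x))}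

/-- `E` and `F` are `(Φ, A)`-orthogonal. -/
def ChartOrthogonal (Φ : Chart G ℓ Γ) (A : Rect ℓ) (E F : X → X → Prop) : Prop :=
  A.IsCentered ∧ (Rect.smul ((30 * ℓ : ℕ) : ℝ) A).carrier Γ ⊆ Φ.D.carrier Γ ∧
  ∀ i : Fin ℓ,
    Disjoint (chartImgSet Φ ((Rect.smul ((30 * ℓ : ℕ) : ℝ) A).carrier Γ) (bdry Φ E A i))
             (chartImgSet Φ ((Rect.smul ((30 * ℓ : ℕ) : ℝ) A).carrier Γ) (bdry Φ F A i))

end ChartAction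

namespace Rect

variable {ℓ : ℕ} {Γ : Type*}

theorem mem_smul_carrier_iff {lam : ℝ} (hlam : 0 ≤ lam) (A : Rect ℓ) (b : Vec ℓ Γ) :
    b ∈ (smul lam A).carrier Γ ↔
      ∀ i, |(b.1 i : ℝ) - A.center i| ≤ lam * A.radius i := by
  refine forall_congr' fun i => ?_
  have h : 0 ≤ ⌊lam * (A.radius i : ℝ)⌋ := Int.floor_nonneg.2 (by positivity)
  simp only [smul, Int.toNat_of_nonneg h, Int.le_floor]
  push_cast
  rfl

theorem mem_carrier_iff (A : Rect ℓ) (b : Vec ℓ Γ) :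
    b ∈ A.carrier Γ ↔ ∀ i, |(b.1 i : ℝ) - A.center i| ≤ A.radius i := by
  refine forall_congr' fun i => ?_
  exact_mod_cast Iff.rfl

/-- A sum of dilated rectangles `λ·A + μ·B` with `B` and `D` centered lies in `D` only if
the corresponding inequality of radii holds. -/
theorem abs_center_add_le_of_add_subset [AddCommGroup Γ] {A B D : Rect ℓ} {m n : ℕ}
    (hB : B.IsCentered) (hD : D.IsCentered)
    (h : (smul (m : ℝ) A).carrier Γ + (smul (n : ℝ) B).carrier Γ ⊆ D.carrier Γ) (i : Fin ℓ) :
    |(A.center i : ℝ)| + m * A.radius i + n * B.radius i ≤ D.radius i := by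
  have key : ∀ σ : ℤ, |σ| = 1 →
      |(A.center i : ℝ) + σ * (m * A.radius i) + σ * (n * B.radius i)| ≤ D.radius i := by
    intro σ hσ
    have hσ' : |(σ : ℝ)| = 1 := by exact_mod_cast hσ
    have hp : ((fun j => A.center j + σ * (m * A.radius j), 0) : Vec ℓ Γ) ∈
        (smul (m : ℝ) A).carrier Γ := by
      rw [mem_smul_carrier_iff m.cast_nonneg]
      intro j
      push_cast
      rw [add_sub_cancel_left, abs_mul, hσ', one_mul, abs_of_nonneg (by positivity)]
    have hq : ((fun j => σ * (n * B.radius j), 0) : Vec ℓ Γ) ∈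
        (smul (n : ℝ) B).carrier Γ := by
      rw [mem_smul_carrier_iff n.cast_nonneg]
      intro j
      rw [hB]
      push_cast
      rw [Pi.zero_apply, Int.cast_zero, sub_zero, abs_mul, hσ', one_mul,
        abs_of_nonneg (by positivity)]
    have := (mem_carrier_iff _ _).1 (h (Set.add_mem_add hp hq)) i
    rw [hD] at this
    simpa using this
  have h1 := key 1 (by simp)
  have h2 := key (-1) (by simp)
  push_cast at h1 h2
  rw [abs_le] at h1 h2
  cases abs_cases (A.center i : ℝ) <;> linarith

end Rect

section ChartAction

variable {G : Type*} [Group G] {ℓ : ℕ} {Γ : Type*} [AddCommGroup Γ]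
  {X : Type*} [MulAction G X]

theorem smul_eq_smul_of_inv_mul_mem_stabilizer {g h : G} {x : X}
    (hgh : g⁻¹ * h ∈ MulAction.stabilizer G x) : h • x = g • x := by
  rw [MulAction.mem_stabilizer_iff, mul_smul, inv_smul_eq_iff] at hgh
  exact hgh

/-- Composition of chart translations at a point of `X^ℋ`. -/
theorem Chart.exists_smul_smul_eq (Φ : Chart G ℓ Γ) {x : X} (hx : x ∈ XH Φ X) {r s : Vec ℓ Γ}
    (hr : r ∈ Φ.D.carrier Γ) (hs : s ∈ Φ.D.carrier Γ)
    (hrs : ∀ z ∈ Φ.Z.carrier Γ, r + s + z ∈ Φ.D.carrier Γ) :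
    ∃ z ∈ Φ.Z.carrier Γ, Φ.φ r • Φ.φ s • x = Φ.φ (r + s + z) • x := by
  obtain ⟨z, hz, h⟩ := Φ.mul_mem r hr s hs _ hx (Set.image_subset_iff.2 hrs)
  exact ⟨z, hz, by rw [← mul_smul]; exact smul_eq_smul_of_inv_mul_mem_stabilizer h⟩

/-- Composition of a chart translation with an inverse one at a point of `X^ℋ`. -/
theorem Chart.exists_smul_inv_smul_eq (Φ : Chart G ℓ Γ) {x : X} (hx : x ∈ XH Φ X)
    {r s : Vec ℓ Γ} (hr : r ∈ Φ.D.carrier Γ) (hs : s ∈ Φ.D.carrier Γ)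
    (hrs : ∀ z ∈ Φ.Z.carrier Γ, r - s + z ∈ Φ.D.carrier Γ) :
    ∃ z ∈ Φ.Z.carrier Γ, Φ.φ r • (Φ.φ s)⁻¹ • x = Φ.φ (r - s + z) • x := by
  obtain ⟨z, hz, h⟩ := Φ.mul_inv_mem r hr s hs _ hx (Set.image_subset_iff.2 hrs)
  exact ⟨z, hz, by rw [← mul_smul]; exact smul_eq_smul_of_inv_mul_mem_stabilizer h⟩

theorem Chart.mem_Z_iff (Φ : Chart G ℓ Γ) (z : Vec ℓ Γ) :
    z ∈ Φ.Z.carrier Γ ↔ ∀ i, |(z.1 i : ℝ)| ≤ Φ.Z.radius i := by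
  rw [Rect.mem_carrier_iff, Φ.Z_centered]
  simp

theorem Chart.mem_D_iff (Φ : Chart G ℓ Γ) (b : Vec ℓ Γ) :
    b ∈ Φ.D.carrier Γ ↔ ∀ i, |(b.1 i : ℝ)| ≤ Φ.D.radius i := by
  rw [Rect.mem_carrier_iff, Φ.D_centered]
  simp

theorem RoughlyAt.two_mul_Z_radius_le {Φ : Chart G ℓ Γ} {A : Rect ℓ} {ε : ℝ} {R : Set X} {x : X}
    (hR : RoughlyAt Φ A ε R x) (i : Fin ℓ) :
    2 * (Φ.Z.radius i : ℝ) ≤ ε * A.radius i := by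
  obtain ⟨hε, -, -, -, hZ, -⟩ := hR
  have h0 : (0 : ℝ) ≤ ε * A.radius i := by positivity
  have h := hZ i
  have h2 : ⌊(2 : ℝ) * (Φ.Z.radius i : ℝ)⌋ = 2 * (Φ.Z.radius i : ℤ) := by
    rw [Int.floor_eq_iff]
    push_cast
    constructor <;> linarith
  simp only [Rect.smul, h2] at h
  have h3 : 2 * (Φ.Z.radius i : ℤ) ≤ ⌊ε * (A.radius i : ℝ)⌋ := by
    have := Int.floor_nonneg.2 h0
    omega
  exact_mod_cast Int.le_floor.1 h3

/-- If passing between the base points `x` and `y` shifts chart coordinates by `u` up to an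
error in `𝒵`, then a rough rectangle at `x` is also one at `y`. -/
theorem RoughlyAt.translate_neg {Φ : Chart G ℓ Γ} {A : Rect ℓ} {ε : ℝ} {R : Set X} {x y : X}
    (hR : RoughlyAt Φ A ε R x) (hε : ε < 1 / 2) (hy : y ∈ XH Φ X) (u : Vec ℓ Γ)
    (hdom : ∀ i, |(u.1 i : ℝ) - A.center i| + 2 * A.radius i ≤ Φ.D.radius i)
    (hyx : ∀ w, (∀ i, |((w + u).1 i : ℝ) - A.center i| ≤ A.radius i) →
      ∃ z ∈ Φ.Z.carrier Γ, Φ.φ w • y = Φ.φ (w + u + z) • x)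
    (hxy : ∀ s, (∀ i, |(s.1 i : ℝ) - A.center i| ≤ 2 * A.radius i) →
      ∃ z ∈ Φ.Z.carrier Γ, Φ.φ s • x = Φ.φ (s - u + z) • y) :
    RoughlyAt Φ (A.translate (-u)) (2 * ε) R y := by
  have hZ := hR.two_mul_Z_radius_le
  obtain ⟨hε0, -, -, -, hle, hin, hout⟩ := hR
  refine ⟨by linarith, by linarith, hy, ?_, ?_, ?_, ?_⟩
  · intro b hb
    rw [Rect.mem_smul_carrier_iff zero_le_two] at hb
    rw [Φ.mem_D_iff]
    intro i
    have h1 := hb i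
    have h2 := hdom i
    simp only [Rect.translate, Prod.fst_neg, Pi.neg_apply] at h1
    push_cast at h1
    cases abs_cases ((u.1 i : ℝ) - A.center i) <;> rw [abs_le] at * <;> constructor <;> linarith
  · intro i
    refine (hle i).trans (Int.toNat_le_toNat (Int.floor_le_floor ?_))
    simp only [Rect.translate]
    gcongr
    linarith
  · rintro _ ⟨w, hw, rfl⟩
    rw [Rect.mem_smul_carrier_iff (by linarith)] at hw
    simp only [Rect.translate, Prod.fst_neg, Pi.neg_apply] at hw
    push_cast at hw
    have ha : ∀ i, 0 ≤ ε * (A.radius i : ℝ) := fun i => by positivity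
    obtain ⟨z, hz, h⟩ := hyx w fun i => by
      have h1 := hw i
      have h2 := ha i
      rw [abs_le] at *
      simp only [Prod.fst_add, Pi.add_apply]
      push_cast
      constructor <;> linarith
    refine hin ⟨w + u + z, ?_, h.symm⟩
    rw [Rect.mem_smul_carrier_iff (by linarith)]
    rw [Φ.mem_Z_iff] at hz
    intro i
    have h1 := hw i
    have h2 := ha i
    have h3 := hz i
    have h4 := hZ i
    rw [abs_le] at *
    simp only [Prod.fst_add, Pi.add_apply]
    push_cast
    constructor <;> linarith
  · intro p hp
    obtain ⟨s, hs, rfl⟩ := hout hp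
    rw [Rect.mem_smul_carrier_iff (by linarith)] at hs
    obtain ⟨z, hz, h⟩ := hxy s fun i =>
      (hs i).trans (mul_le_mul_of_nonneg_right (by linarith) (by positivity))
    refine ⟨s - u + z, ?_, h.symm⟩
    rw [Rect.mem_smul_carrier_iff (by linarith)]
    rw [Φ.mem_Z_iff] at hz
    intro i
    have h1 := hs i
    have h2 : 0 ≤ ε * (A.radius i : ℝ) := by positivity
    have h3 := hz i
    have h4 := hZ i
    rw [abs_le] at *
    simp only [Rect.translate, Prod.fst_add, Pi.add_apply, Prod.fst_neg, Pi.neg_apply,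
      Prod.fst_sub, Pi.sub_apply]
    push_cast
    constructor <;> linarith

end ChartAction

/-- **Lemma 4.2 (translating the base point of a rough rectangle).**
Let `G` act on `X`, let `Φ` be a chart for `G`, let `R ⊆ X` be `(Φ, ε)`-roughly `A` at
`x ∈ X^ℋ` with `ε < 1/2`, and let `M` be a positive integer with `(M+2)·A + 4·𝒵 ⊆ dom(φ)`.
Let `y ∈ X^ℋ`.
(i) If `y = φ(𝐮)·x` with `𝐮 ∈ M·A`, then `R` is `(Φ, 2ε)`-roughly `A − 𝐮` at `y`.
(ii) If `x = φ(𝐯)·y` with `−𝐯 ∈ M·A`, then `R` is `(Φ, 2ε)`-roughly `A + 𝐯` at `y`. -/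
theorem roughly_shift {G X : Type*} [Group G] [Countable G] [MulAction G X]
    {ℓ : ℕ} {Γ : Type*} [AddCommGroup Γ] (Φ : Chart G ℓ Γ)
    (A : Rect ℓ) (ε : ℝ) (R : Set X) (x : X)
    (hR : RoughlyAt Φ A ε R x) (hε : ε < 1 / 2)
    (M : ℕ) (hM : 0 < M)
    (hdom : (Rect.smul ((M : ℝ) + 2) A).carrier Γ + (Rect.smul 4 Φ.Z).carrier Γ
      ⊆ Φ.D.carrier Γ)
    (y : X) (hy : y ∈ XH Φ X) :
    (∀ u ∈ (Rect.smul (M : ℝ) A).carrier Γ, y = Φ.φ u • x →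
      RoughlyAt Φ (A.translate (-u)) (2 * ε) R y) ∧
    (∀ v : Vec ℓ Γ, -v ∈ (Rect.smul (M : ℝ) A).carrier Γ → x = Φ.φ v • y →
      RoughlyAt Φ (A.translate v) (2 * ε) R y) := by
  have hD : ∀ i, |(A.center i : ℝ)| + (M + 2) * A.radius i + 4 * Φ.Z.radius i ≤
      Φ.D.radius i := fun i => by
    have h := Rect.abs_center_add_le_of_add_subset (Γ := Γ) (A := A) (m := M + 2) (n := 4)
      Φ.Z_centered Φ.D_centered (by exact_mod_cast hdom) i
    exact_mod_cast h
  have hMa : ∀ i, (A.radius i : ℝ) ≤ M * A.radius i := fun i =>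
    le_mul_of_one_le_left (by positivity) (by exact_mod_cast hM)
  have memD : ∀ b : Vec ℓ Γ, (∀ i, |(b.1 i : ℝ)| ≤
      |(A.center i : ℝ)| + (M + 2) * A.radius i + Φ.Z.radius i) → b ∈ Φ.D.carrier Γ := by
    intro b hb
    rw [Φ.mem_D_iff]
    intro i
    have h1 := hb i
    have h2 := hD i
    have h3 : (0 : ℝ) ≤ Φ.Z.radius i := by positivity
    linarith
  have hx := hR.2.2.1
  have shift : ∀ u ∈ (Rect.smul (M : ℝ) A).carrier Γ,
      u ∈ Φ.D.carrier Γ ∧ -u ∈ Φ.D.carrier Γ ∧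
      (∀ i, |(u.1 i : ℝ) - A.center i| + 2 * A.radius i ≤ Φ.D.radius i) ∧
      (∀ w : Vec ℓ Γ, (∀ i, |((w + u).1 i : ℝ) - A.center i| ≤ A.radius i) →
        w ∈ Φ.D.carrier Γ ∧ ∀ z ∈ Φ.Z.carrier Γ, w + u + z ∈ Φ.D.carrier Γ) ∧
      (∀ s : Vec ℓ Γ, (∀ i, |(s.1 i : ℝ) - A.center i| ≤ 2 * A.radius i) →
        s ∈ Φ.D.carrier Γ ∧ ∀ z ∈ Φ.Z.carrier Γ, s - u + z ∈ Φ.D.carrier Γ) := by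
    intro u hu
    rw [Rect.mem_smul_carrier_iff M.cast_nonneg] at hu
    have ha : ∀ i, (0 : ℝ) ≤ A.radius i := fun i => Nat.cast_nonneg _
    have hz0 : ∀ i, (0 : ℝ) ≤ Φ.Z.radius i := fun i => Nat.cast_nonneg _
    have huc : ∀ i, |(u.1 i : ℝ)| ≤ |(A.center i : ℝ)| + (M + 2) * A.radius i +
        Φ.Z.radius i := fun i => by
      have := abs_sub_abs_le_abs_sub (u.1 i : ℝ) (A.center i)
      linarith [hu i, ha i, hz0 i]
    refine ⟨memD u huc, memD (-u) fun i => ?_, fun i => ?_, fun w hw =>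
      ⟨memD w fun i => ?_, fun z hz => memD _ fun i => ?_⟩, fun s hs =>
      ⟨memD s fun i => ?_, fun z hz => memD _ fun i => ?_⟩⟩
    · simpa using huc i
    · linarith [hu i, hD i, hz0 i, abs_nonneg (A.center i : ℝ)]
    · have h1 := hw i
      have h2 := hu i
      have h3 := abs_nonneg (A.center i : ℝ)
      simp only [Prod.fst_add, Pi.add_apply] at h1
      push_cast at h1
      rw [abs_le] at h1 h2 ⊢
      constructor <;> linarith [ha i, hz0 i]
    · have h1 := hw i
      have h2 := (Φ.mem_Z_iff z).1 hz i
      have h3 := abs_sub_abs_le_abs_sub ((w + u).1 i : ℝ) (A.center i)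
      have h4 := abs_add_le ((w + u).1 i : ℝ) (z.1 i)
      rw [Prod.fst_add (w + u), Pi.add_apply (w + u).1]
      push_cast at *
      linarith [hMa i, ha i]
    · have h1 := abs_sub_abs_le_abs_sub (s.1 i : ℝ) (A.center i)
      have h2 := hMa i
      linarith [hs i, ha i, hz0 i]
    · have h1 := hs i
      have h2 := hu i
      have h3 := (Φ.mem_Z_iff z).1 hz i
      have h4 := abs_nonneg (A.center i : ℝ)
      simp only [Prod.fst_add, Prod.fst_sub, Pi.add_apply, Pi.sub_apply]
      push_cast
      rw [abs_le] at h1 h2 h3 ⊢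
      constructor <;> linarith
  constructor
  · rintro u hu rfl
    obtain ⟨huD, -, hdist, hw, hs⟩ := shift u hu
    refine hR.translate_neg hε hy u hdist
      (fun w h => Φ.exists_smul_smul_eq hx (hw w h).1 huD (hw w h).2) (fun s h => ?_)
    simpa only [inv_smul_smul] using Φ.exists_smul_inv_smul_eq hy (hs s h).1 huD (hs s h).2
  · rintro v hv rfl
    obtain ⟨-, hvD, hdist, hw, hs⟩ := shift (-v) hv
    simp only [neg_neg, sub_neg_eq_add, ← sub_eq_add_neg] at hvD hw hs
    have key := hR.translate_neg hε hy (-v) hdist (fun w h => ?_) (fun s h => ?_)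
    · rwa [neg_neg] at key
    · rw [← sub_eq_add_neg] at h ⊢
      simpa only [inv_smul_smul] using Φ.exists_smul_inv_smul_eq hx (hw w h).1 hvD (hw w h).2
    · rw [sub_neg_eq_add]
      exact Φ.exists_smul_smul_eq hy (hs s h).1 hvD (hs s h).2
end

section
/- Let a countable group G act continuously on a Polish space X, let Φ = (ℓ, φ, 𝒵, Γ, ℋ) be a chart for G, and let E be an equivalence relation on X. If X^ℋ is clopen and E is G-clopen, then the boundary ∂_i^Φ(E, A) is clopen for every centered rectangle A ⊆ (ℤ^ℓ × Γ) ∩ dom(φ) and every 1 ≤ i ≤ ℓ. -/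
open Pointwise

namespace Rect

/-- A rectangle has finitely many points when `Γ` is finite. -/
theorem finite_carrier {ℓ : ℕ} (A : Rect ℓ) (Γ : Type*) [Finite Γ] : (A.carrier Γ).Finite := by
  refine ((Set.finite_Icc (fun i => A.center i - (A.radius i : ℤ))
    (fun i => A.center i + (A.radius i : ℤ))).prod (Set.finite_univ (α := Γ))).subset ?_
  intro b hb
  refine ⟨⟨fun i => ?_, fun i => ?_⟩, Set.mem_univ _⟩
  · have := abs_le.mp (hb i)
    dsimp only
    linarith
  · have := abs_le.mp (hb i)
    dsimp only
    linarith

end Rect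

/-- Saturations under an equivalence relation are disjoint iff no two points of the sets are
related. -/
theorem disjoint_eSat_iff {X : Type*} {E : X → X → Prop} (hE : Equivalence E) {S T : Set X} :
    Disjoint (eSat E S) (eSat E T) ↔ ∀ s ∈ S, ∀ t ∈ T, ¬ E s t := by
  rw [Set.disjoint_left]
  constructor
  · intro h s hs t ht hst
    exact h ⟨s, hs, hst⟩ ⟨t, ht, hE.refl t⟩
  · rintro h y ⟨s, hs, hsy⟩ ⟨t, ht, hty⟩
    exact h s hs t ht (hE.trans hsy (hE.symm hty))

/-- For a `G`-clopen relation `E`, the set of `x` with `g • x` related to `h • x` is clopen. -/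
theorem isClopen_setOf_rel_smul_smul {G X : Type*} [Group G] [TopologicalSpace X] [MulAction G X]
    (hcont : ∀ g : G, Continuous fun x : X => g • x) {E : X → X → Prop}
    (hGclopen : ∀ g : G, IsClopen {x : X | E x (g • x)}) (g h : G) :
    IsClopen {x : X | E (g • x) (h • x)} := by
  have := (hGclopen (h * g⁻¹)).preimage (hcont g)
  simpa [Set.preimage, smul_smul] using this

/-- **Lemma 5.2 (boundaries of `G`-clopen equivalence relations are clopen).**
Let `G` act continuously on a Polish space `X`, let `Φ = (ℓ, φ, 𝒵, Γ, ℋ)` be a chart for `G`,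
and let `E` be an equivalence relation on `X`. If `X^ℋ` is clopen and `E` is `G`-clopen, then
`∂_i^Φ(E, A)` is clopen for every centered rectangle `A ⊆ dom(φ)` and every `1 ≤ i ≤ ℓ`. -/
theorem bdry_clopen {G X : Type*} [Group G] [Countable G]
    [TopologicalSpace X] [PolishSpace X] [MulAction G X]
    (hcont : ∀ g : G, Continuous fun x : X => g • x)
    {ℓ : ℕ} {Γ : Type*} [AddCommGroup Γ] (Φ : Chart G ℓ Γ)
    (E : X → X → Prop) (hE : Equivalence E)
    (hXH : IsClopen (XH Φ X))
    (hGclopen : ∀ g : G, IsClopen {x : X | E x (g • x)})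
    (A : Rect ℓ) (hA : A.IsCentered) (hAdom : A.carrier Γ ⊆ Φ.D.carrier Γ)
    (i : Fin ℓ) :
    IsClopen (bdry Φ E A i) := by
  have := Φ.Γ_finite
  have hrw : bdry Φ E A i = XH Φ X ∩ ⋂ u ∈ (A.faceRect i (-1)).carrier Γ,
      ⋂ v ∈ (A.faceRect i 1).carrier Γ, {x | E (Φ.φ u • x) (Φ.φ v • x)}ᶜ := by
    ext x
    simp only [bdry, disjoint_eSat_iff hE, chartImg, Set.forall_mem_image, Set.mem_ofPred_eq,
      Set.mem_inter_iff, Set.mem_iInter, Set.mem_compl_iff]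
  rw [hrw]
  exact hXH.inter <| (Rect.finite_carrier _ Γ).isClopen_biInter fun u _ =>
    (Rect.finite_carrier _ Γ).isClopen_biInter fun v _ =>
      (isClopen_setOf_rel_smul_smul hcont hGclopen _ _).compl
end

section
/- Let a countable group G act on a set X, let Φ = (ℓ, φ, 𝒵, Γ, ℋ) be a chart for G, let ε > 0, let q satisfy 12ε < q < 1/(24ℓ), and let A ⊆ ℤ^ℓ × Γ be a centered rectangle. Suppose E is a (Φ, A, ε)-sub-rectangular equivalence relation on X. If x ∈ X^ℋ satisfies φ(15ℓq·A)·x ⊆ X^ℋ and φ(3·𝒵)·x ⊄ [x]_E, then there is 1 ≤ i ≤ ℓ with x ∈ φ(30ℓ·(q·A))·∂_i^Φ(E, q·A). -/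
open Pointwise

/-- Every point of the window `|v_j| ≤ 15 K_j` has an `F`-class which, inside that window, lies
between two concentric boxes of nearly equal large radii `r ≤ R`. -/
def BoxClasses {ℓ : ℕ} {Γ : Type*} (u K : Fin ℓ → ℤ) (F : Vec ℓ Γ → Vec ℓ Γ → Prop) : Prop :=
  ∀ v : Vec ℓ Γ, (∀ j, -(15 * K j) ≤ v.1 j ∧ v.1 j ≤ 15 * K j) →
    ∃ m r R : Fin ℓ → ℤ,
      (∀ j, 4 * (R j - r j) ≤ u j ∧ r j ≤ R j ∧ 20 * K j ≤ r j) ∧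
      (∀ w : Vec ℓ Γ, (∀ j, -(15 * K j) ≤ w.1 j ∧ w.1 j ≤ 15 * K j) →
        (∀ j, m j - r j ≤ w.1 j ∧ w.1 j ≤ m j + r j) → F v w) ∧
      (∀ w : Vec ℓ Γ, (∀ j, -(15 * K j) ≤ w.1 j ∧ w.1 j ≤ 15 * K j) → F v w →
        ∀ j, m j - R j ≤ w.1 j ∧ w.1 j ≤ m j + R j)

/-- Around every point `y` with `|y_j| ≤ 12 K_j`, some point of the (`ζ`-thickened) face of
`y + [-u, u]` perpendicular to `e_i` is `E`-related to some point of the opposite face. -/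
def FacesLinked {ℓ : ℕ} {Γ : Type*} (u K ζ : Fin ℓ → ℤ) (E : Vec ℓ Γ → Vec ℓ Γ → Prop) : Prop :=
  ∀ y : Vec ℓ Γ, (∀ j, -(12 * K j) ≤ y.1 j ∧ y.1 j ≤ 12 * K j) → ∀ i, ∃ w w' : Vec ℓ Γ,
    E w w' ∧
    (∀ j, y.1 j - (u j + ζ j) ≤ w.1 j ∧ w.1 j ≤ y.1 j + (u j + ζ j)) ∧
    (∀ j, y.1 j - (u j + ζ j) ≤ w'.1 j ∧ w'.1 j ≤ y.1 j + (u j + ζ j)) ∧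
    w.1 i ≤ y.1 i - u i + ζ i ∧ y.1 i + u i - ζ i ≤ w'.1 i

section Combinatorics

variable {ℓ : ℕ} {Γ : Type*} {u K ζ : Fin ℓ → ℤ} {E F : Vec ℓ Γ → Vec ℓ Γ → Prop}

/-- Without leaving its `E`-class, a point can be moved far in any one coordinate direction while
its other coordinates change only by a bounded multiple of `u`. -/
theorem exists_related_far_in_direction (hE : Equivalence E) (hF : Equivalence F)
    (hFE : ∀ v w, F v w → E v w) (hu : ∀ j, 48 ≤ u j) (huK : ∀ j, u j ≤ K j)
    (hζ : ∀ j, 0 ≤ ζ j ∧ 48 * ζ j ≤ u j) (hbox : BoxClasses u K F) (hlink : FacesLinked u K ζ E)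
    (i : Fin ℓ) (s : ℤ) (hs : s = 1 ∨ s = -1) (p : Vec ℓ Γ)
    (hpi : -(3 * K i) ≤ p.1 i ∧ p.1 i ≤ 3 * K i)
    (hp : ∀ j, -(9 * K j) ≤ p.1 j ∧ p.1 j ≤ 9 * K j) :
    ∃ p' : Vec ℓ Γ, E p p' ∧
      (∀ j, j ≠ i → p.1 j - 3 * u j ≤ p'.1 j ∧ p'.1 j ≤ p.1 j + 3 * u j) ∧
      4 * K i ≤ s * p'.1 i ∧ s * p'.1 i ≤ 4 * K i + 2 * u i := by
  have hpN : ∀ j, -(15 * K j) ≤ p.1 j ∧ p.1 j ≤ 15 * K j := fun j => by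
    have := hp j; have := hu j; have := huK j; omega
  obtain ⟨m, r, R, hb, hin, hout⟩ := hbox p hpN
  have hpm := hout p hpN (hF.refl p)
  by_cases h : 4 * K i ≤ s * m i + r i
  · have hcoord : ∀ j,
        let c := if j = i then s * max (4 * K i) (s * m i - r i)
          else if p.1 j ≤ m j then p.1 j + (R j - r j) else p.1 j - (R j - r j)
        (-(15 * K j) ≤ c ∧ c ≤ 15 * K j) ∧ (m j - r j ≤ c ∧ c ≤ m j + r j) ∧
        (j ≠ i → p.1 j - 3 * u j ≤ c ∧ c ≤ p.1 j + 3 * u j) ∧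
        (j = i → 4 * K i ≤ s * c ∧ s * c ≤ 4 * K i + 2 * u i) := by
      intro j
      have := hp j; have := hu j; have := huK j; have := hb j; have := hpm j
      rcases eq_or_ne j i with rfl | hj
      · rcases hs with rfl | rfl <;> simp only [if_true] <;> omega
      · simp only [hj, if_false, false_implies, and_true]
        split_ifs <;> omega
    refine ⟨(_, p.2), hFE _ _ (hin _ (fun j => (hcoord j).1) (fun j => (hcoord j).2.1)),
      fun j => (hcoord j).2.2.1, (hcoord i).2.2.2 rfl⟩
  · obtain ⟨w, w', hww, hw, hw', hwi, hwi'⟩ : ∃ w w' : Vec ℓ Γ, E w w' ∧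
        (∀ j, j ≠ i → (m j - r j ≤ w.1 j ∧ w.1 j ≤ m j + r j) ∧
          (p.1 j - 3 * u j ≤ w.1 j ∧ w.1 j ≤ p.1 j + 3 * u j)) ∧
        (∀ j, j ≠ i → (m j - r j + u j / 4 ≤ w'.1 j ∧ w'.1 j ≤ m j + r j - u j / 4) ∧
          (p.1 j - 3 * u j + u j / 4 ≤ w'.1 j ∧ w'.1 j ≤ p.1 j + 3 * u j - u j / 4)) ∧
        (s * m i + R i - u i - ζ i ≤ s * w.1 i ∧ s * w.1 i ≤ s * m i + R i - u i + ζ i) ∧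
        (s * m i + R i + u i - ζ i ≤ s * w'.1 i ∧ s * w'.1 i ≤ s * m i + R i + u i + ζ i) := by
      let y : Vec ℓ Γ := (fun j => if j = i then m i + s * R i else
        if p.1 j ≤ m j then p.1 j + (u j + ζ j + (R j - r j) + u j / 4)
        else p.1 j - (u j + ζ j + (R j - r j) + u j / 4), p.2)
      have hyi : y.1 i = m i + s * R i := by simp [y]
      have hyN : ∀ j, -(12 * K j) ≤ y.1 j ∧ y.1 j ≤ 12 * K j := by
        intro j
        have := hp j; have := hu j; have := huK j; have := hb j; have := hpm j; have := hζ j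
        rcases eq_or_ne j i with rfl | hj
        · rw [hyi]
          rcases hs with rfl | rfl <;> omega
        · simp only [y, hj, if_false]
          split_ifs <;> omega
      have hyj : ∀ j, j ≠ i → ∀ a : ℤ, y.1 j - (u j + ζ j) ≤ a ∧ a ≤ y.1 j + (u j + ζ j) →
          (m j - r j + u j / 4 ≤ a ∧ a ≤ m j + r j - u j / 4) ∧
          (p.1 j - 3 * u j + u j / 4 ≤ a ∧ a ≤ p.1 j + 3 * u j - u j / 4) := by
        intro j hj a
        have := hp j; have := hu j; have := huK j; have := hb j; have := hpm j; have := hζ j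
        simp only [y, hj, if_false]
        split_ifs <;> omega
      have hweak : ∀ j, j ≠ i → ∀ a : ℤ, y.1 j - (u j + ζ j) ≤ a ∧ a ≤ y.1 j + (u j + ζ j) →
          (m j - r j ≤ a ∧ a ≤ m j + r j) ∧
          (p.1 j - 3 * u j ≤ a ∧ a ≤ p.1 j + 3 * u j) := by
        intro j hj a ha
        have := hyj j hj a ha; have := hu j
        omega
      obtain ⟨w, w', hww, hw, hw', hwi, hwi'⟩ := hlink y hyN i
      have h1 := hw i
      have h2 := hw' i
      rw [hyi] at hwi hwi' h1 h2
      rcases hs with rfl | rfl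
      · exact ⟨w, w', hww, fun j hj => hweak j hj _ (hw j), fun j hj => hyj j hj _ (hw' j),
          by omega, by omega⟩
      · exact ⟨w', w, hE.symm hww, fun j hj => hweak j hj _ (hw' j),
          fun j hj => hyj j hj _ (hw j), by omega, by omega⟩
    have hpw : F p w := by
      refine hin w (fun j => ?_) (fun j => ?_) <;>
      · have := hp j; have := hu j; have := huK j; have := hb j; have := hpm j; have := hζ j
        rcases eq_or_ne j i with rfl | hj
        · rcases hs with rfl | rfl <;> omega
        · have := hw j hj
          omega
    have hwN : ∀ j, -(15 * K j) ≤ w'.1 j ∧ w'.1 j ≤ 15 * K j := by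
      intro j
      have := hp j; have := hu j; have := huK j; have := hb j; have := hpm j; have := hζ j
      rcases eq_or_ne j i with rfl | hj
      · rcases hs with rfl | rfl <;> omega
      · have := hw' j hj
        omega
    obtain ⟨m', r', R', hb', hin', hout'⟩ := hbox w' hwN
    have hwm := hout' w' hwN (hF.refl w')
    have hnew : ∀ j, j ≠ i →
        let c := if w'.1 j ≤ m' j then w'.1 j + (R' j - r' j) else w'.1 j - (R' j - r' j)
        (-(15 * K j) ≤ c ∧ c ≤ 15 * K j) ∧ (m j - r j ≤ c ∧ c ≤ m j + r j) ∧
        (m' j - r' j ≤ c ∧ c ≤ m' j + r' j) ∧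
        (p.1 j - 3 * u j ≤ c ∧ c ≤ p.1 j + 3 * u j) := by
      intro j hj
      have := hp j; have := hu j; have := huK j; have := hb' j; have := hwm j; have := hw' j hj
      dsimp only
      split_ifs <;> omega
    have hi1 := hp i
    have hi2 := hu i
    have hi3 := huK i
    have hi4 := hb i
    have hi5 := hb' i
    have hi6 := hpm i
    have hi7 := hwm i
    have hi8 := hζ i
    have hdir : s * w'.1 i ≤ s * m' i := by
      by_contra hlt
      have hcoord : ∀ j,
          let c := if j = i then m i + s * r i else
            if w'.1 j ≤ m' j then w'.1 j + (R' j - r' j) else w'.1 j - (R' j - r' j)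
          (-(15 * K j) ≤ c ∧ c ≤ 15 * K j) ∧ (m j - r j ≤ c ∧ c ≤ m j + r j) ∧
          (m' j - r' j ≤ c ∧ c ≤ m' j + r' j) := by
        intro j
        rcases eq_or_ne j i with rfl | hj
        · simp only [if_true]
          rcases hs with rfl | rfl <;> omega
        · have := hnew j hj
          simp only [hj, if_false]
          exact ⟨this.1, this.2.1, this.2.2.1⟩
      have hpv := hin (_, p.2) (fun j => (hcoord j).1) (fun j => (hcoord j).2.1)
      have hwv := hin' (_, p.2) (fun j => (hcoord j).1) (fun j => (hcoord j).2.2)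
      have := hout w' hwN (hF.trans hpv (hF.symm hwv)) i
      rcases hs with rfl | rfl <;> omega
    have hcoord : ∀ j,
        let c := if j = i then s * max (4 * K i) (s * w'.1 i + (R' i - r' i)) else
          if w'.1 j ≤ m' j then w'.1 j + (R' j - r' j) else w'.1 j - (R' j - r' j)
        (-(15 * K j) ≤ c ∧ c ≤ 15 * K j) ∧ (m' j - r' j ≤ c ∧ c ≤ m' j + r' j) ∧
        (j ≠ i → p.1 j - 3 * u j ≤ c ∧ c ≤ p.1 j + 3 * u j) ∧
        (j = i → 4 * K i ≤ s * c ∧ s * c ≤ 4 * K i + 2 * u i) := by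
      intro j
      rcases eq_or_ne j i with rfl | hj
      · simp only [if_true]
        rcases hs with rfl | rfl <;> omega
      · have := hnew j hj
        simp only [hj, if_false]
        exact ⟨this.1, this.2.2.1, fun _ => this.2.2.2, fun h => h.elim⟩
    refine ⟨(_, p.2), hE.trans (hFE _ _ hpw) (hE.trans hww (hFE _ _
      (hin' _ (fun j => (hcoord j).1) (fun j => (hcoord j).2.1)))),
      fun j => (hcoord j).2.2.1, (hcoord i).2.2.2 rfl⟩

/-- If opposite faces are linked everywhere near the origin, the origin is `E`-related to every
point close to it. -/
theorem related_of_facesLinked [Zero Γ] (hE : Equivalence E) (hF : Equivalence F)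
    (hFE : ∀ v w, F v w → E v w) (hu : ∀ j, 48 ≤ u j) (hK : ∀ j, K j = ℓ * u j)
    (hζ : ∀ j, 0 ≤ ζ j ∧ 48 * ζ j ≤ u j) (hbox : BoxClasses u K F) (hlink : FacesLinked u K ζ E)
    (t : Vec ℓ Γ) (ht : ∀ j, -u j ≤ 4 * t.1 j ∧ 4 * t.1 j ≤ u j) : E 0 t := by
  have hcK : ∀ (k : ℕ) (j : Fin ℓ), k ≤ ℓ → 0 ≤ (k : ℤ) * u j ∧ (k : ℤ) * u j ≤ K j := by
    intro k j hk
    have h0 : (0 : ℤ) ≤ u j := by have := hu j; omega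
    have hk' : (k : ℤ) ≤ ℓ := by exact_mod_cast hk
    rw [hK]
    exact ⟨by positivity, mul_le_mul_of_nonneg_right hk' h0⟩
  have huK : ∀ j, u j ≤ K j := by
    intro j
    have := (hcK 1 j (by have := j.2; omega)).2
    simpa using this
  have htN : ∀ j, -(15 * K j) ≤ t.1 j ∧ t.1 j ≤ 15 * K j := fun j => by
    have := ht j; have := hu j; have := huK j; omega
  obtain ⟨m, r, R, hb, hin, hout⟩ := hbox t htN
  have htm := hout t htN (hF.refl t)
  let s : Fin ℓ → ℤ := fun j => if t.1 j ≤ m j then 1 else -1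
  have hs : ∀ j, s j = 1 ∨ s j = -1 := fun j => by simp only [s]; split_ifs <;> simp
  have main : ∀ k : ℕ, k ≤ ℓ → ∃ p : Vec ℓ Γ, E 0 p ∧ ∀ j : Fin ℓ,
      ((j : ℕ) < k → 4 * K j - 3 * (k * u j) ≤ s j * p.1 j ∧
        s j * p.1 j ≤ 4 * K j + 2 * u j + 3 * (k * u j)) ∧
      (k ≤ (j : ℕ) → -(3 * (k * u j)) ≤ p.1 j ∧ p.1 j ≤ 3 * (k * u j)) := by
    intro k
    induction k with
    | zero => exact fun _ => ⟨0, hE.refl 0, fun j => by simp⟩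
    | succ k ih =>
      intro hk
      obtain ⟨p, hp, hpk⟩ := ih (by omega)
      obtain ⟨p', hpp', hj', hi'⟩ := exists_related_far_in_direction hE hF hFE hu huK hζ hbox hlink
        ⟨k, hk⟩ (s ⟨k, hk⟩) (hs _) p
        (by have := (hpk ⟨k, hk⟩).2 le_rfl; have := hcK k ⟨k, hk⟩ (by omega); omega)
        (fun j => by
          have hpj := hpk j; have := hcK k j (by omega); have := huK j; have := hu j
          rcases hs j with h | h <;> rw [h] at hpj <;> omega)
      refine ⟨p', hE.trans hp hpp', fun j => ?_⟩
      have hsucc : ((k + 1 : ℕ) : ℤ) * u j = k * u j + u j := by push_cast; ring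
      rw [hsucc]
      have h1 := hpk j
      have h2 := hcK k j (by omega)
      have h3 := huK j
      have h4 := hu j
      by_cases hjk : j = ⟨k, hk⟩
      · subst hjk
        exact ⟨fun _ => by omega, fun h => absurd h (by simp)⟩
      · have h5 := hj' j hjk
        have hne : (j : ℕ) ≠ k := fun h => hjk (Fin.ext h)
        rcases hs j with h | h <;> rw [h] at h1 ⊢ <;> omega
  obtain ⟨p, hp, hpk⟩ := main ℓ le_rfl
  have hcoord : ∀ j, (-(15 * K j) ≤ p.1 j ∧ p.1 j ≤ 15 * K j) ∧
      (m j - r j ≤ p.1 j ∧ p.1 j ≤ m j + r j) := by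
    intro j
    have h1 := (hpk j).1 j.2
    rw [← hK] at h1
    have := hb j; have := htm j; have := ht j; have := hu j; have := huK j
    simp only [s] at h1
    split_ifs at h1 <;> omega
  exact hE.trans hp (hE.symm (hFE _ _ (hin p (fun j => (hcoord j).1) (fun j => (hcoord j).2))))

end Combinatorics

/-- The numerical estimates, in one coordinate, behind the boxes of a rectangular relation. -/
theorem radius_estimates {ε q δ : ℝ} {ℓ a b z : ℕ} (hℓ : 0 < ℓ) (hε : 0 < ε)
    (hq1 : 12 * ε < q) (hq2 : q < 1 / (24 * (ℓ : ℝ))) (hδ : 0 < δ) (hδ1 : δ < 1)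
    (hz : 0 < z) (hab : a ≤ b)
    (h1 : (⌊(2 : ℝ) * z⌋).toNat ≤ (⌊δ * b⌋).toNat)
    (h2 : (⌊2 * δ * b⌋).toNat ≤ (⌊ε * a⌋).toNat) :
    let u : ℤ := (⌊q * a⌋).toNat
    let r : ℤ := (⌊(1 - δ) * b⌋).toNat - 2 * (z : ℤ)
    let R : ℤ := (⌊(1 + δ) * b⌋).toNat + 2 * (z : ℤ)
    48 * (z : ℤ) ≤ u ∧ 4 * (R - r) ≤ u ∧ r ≤ R ∧ r ≤ b ∧ 20 * (ℓ * u) ≤ r ∧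
      15 * (ℓ * u) ≤ a ∧ 15 * (ℓ * u) ≤ (⌊15 * (ℓ : ℝ) * q * a⌋).toNat := by
  have hℓ' : (1 : ℝ) ≤ ℓ := by exact_mod_cast hℓ
  have ha : (0 : ℝ) ≤ a := by positivity
  have hb0 : (0 : ℝ) ≤ b := by positivity
  have hab' : (a : ℝ) ≤ b := by exact_mod_cast hab
  have hz' : (1 : ℝ) ≤ z := by exact_mod_cast hz
  have hq0 : 0 < q := by linarith
  have hqℓ : 24 * (ℓ * q) ≤ 1 := by
    rw [lt_div_iff₀ (by positivity)] at hq2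
    linarith
  have hδb : (0 : ℝ) ≤ δ * b := by positivity
  have hεa : (0 : ℝ) ≤ ε * a := by positivity
  have hqa : (0 : ℝ) ≤ q * a := by positivity
  have toNat_cast : ∀ {t : ℝ}, 0 ≤ t → (((⌊t⌋).toNat : ℕ) : ℤ) = ⌊t⌋ :=
    fun ht => Int.toNat_of_nonneg (Int.floor_nonneg.2 ht)
  have h1' : 2 * (z : ℝ) ≤ δ * b := by
    zify at h1
    rw [toNat_cast (by positivity), toNat_cast hδb] at h1
    have h3 : ⌊(2 : ℝ) * z⌋ = 2 * (z : ℤ) := by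
      rw [show (2 : ℝ) * z = ((2 * (z : ℤ) : ℤ) : ℝ) by push_cast; ring, Int.floor_intCast]
    rw [h3, Int.le_floor] at h1
    push_cast at h1
    exact h1
  have h2i : ⌊2 * δ * b⌋ ≤ ⌊ε * a⌋ := by
    zify at h2
    rwa [toNat_cast (by positivity), toNat_cast hεa] at h2
  have h2' : 2 * (δ * b) < ε * a + 1 := by
    have h3 := Int.lt_floor_add_one (2 * δ * b)
    have h4 := Int.floor_le (ε * a)
    have h5 : ((⌊2 * δ * b⌋ : ℤ) : ℝ) ≤ ⌊ε * a⌋ := by exact_mod_cast h2i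
    linarith
  have h4z : 4 * (z : ℝ) ≤ ε * a := by
    have h3 : 4 * (z : ℤ) ≤ ⌊2 * δ * b⌋ := by
      rw [Int.le_floor]; push_cast; linarith
    have h4 := Int.le_floor.1 (h3.trans h2i)
    push_cast at h4
    exact h4
  have hqε : 12 * (ε * a) ≤ q * a := by nlinarith
  have hu1 := Int.floor_le (q * a)
  have hu2 := Int.lt_floor_add_one (q * a)
  have hr1 := Int.lt_floor_add_one ((1 - δ) * b)
  have hR1 := Int.floor_le ((1 + δ) * b)
  have hℓqa : 24 * (ℓ * (q * a)) ≤ a := by nlinarith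
  have hℓu : ℓ * ((⌊q * a⌋ : ℤ) : ℝ) ≤ ℓ * (q * a) := by gcongr
  have hqa_le : q * a ≤ ℓ * (q * a) := by nlinarith
  dsimp only
  rw [toNat_cast hqa, toNat_cast (mul_nonneg (by linarith) hb0), toNat_cast (by positivity),
    toNat_cast (by positivity)]
  refine ⟨?_, ?_, ?_, ?_, ?_, ?_, ?_⟩
  · rw [Int.le_floor]; push_cast; linarith
  · have : (4 * ((⌊(1 + δ) * b⌋ + 2 * z) - (⌊(1 - δ) * b⌋ - 2 * z) : ℤ) : ℝ) < ⌊q * a⌋ := by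
      push_cast
      nlinarith
    exact_mod_cast this.le
  · have : ⌊(1 - δ) * (b : ℝ)⌋ ≤ ⌊(1 + δ) * (b : ℝ)⌋ := Int.floor_le_floor (by nlinarith)
    omega
  · have : ⌊(1 - δ) * (b : ℝ)⌋ ≤ b := by
      have := Int.floor_le_floor (show (1 - δ) * (b : ℝ) ≤ b by nlinarith)
      rwa [Int.floor_natCast] at this
    omega
  · have : ((20 * (ℓ * ⌊q * a⌋) : ℤ) : ℝ) ≤ ((⌊(1 - δ) * b⌋ - 2 * z : ℤ) : ℝ) := by
      push_cast
      nlinarith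
    exact_mod_cast this
  · have : ((15 * (ℓ * ⌊q * a⌋) : ℤ) : ℝ) ≤ ((a : ℤ) : ℝ) := by
      push_cast
      nlinarith
    exact_mod_cast this
  · rw [Int.le_floor]; push_cast; nlinarith

section ChartLemmas

variable {G : Type*} [Group G] {ℓ : ℕ} {Γ : Type*} {X : Type*} [MulAction G X]

theorem Rect.mem_carrier_of_isCentered {A : Rect ℓ} (hA : A.IsCentered) {v : Vec ℓ Γ} :
    v ∈ A.carrier Γ ↔ ∀ j, -(A.radius j : ℤ) ≤ v.1 j ∧ v.1 j ≤ A.radius j := by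
  have hc : A.center = 0 := hA
  simp [Rect.carrier, hc, abs_le]

variable [AddCommGroup Γ]

theorem Rect.radius_smul_natCast (n : ℕ) (A : Rect ℓ) (j : Fin ℓ) :
    (Rect.smul (n : ℝ) A).radius j = n * A.radius j := by
  have h : ⌊(n : ℝ) * (A.radius j : ℝ)⌋ = ((n * A.radius j : ℕ) : ℤ) := by
    rw [← Nat.cast_mul, Int.floor_natCast]
  simp only [Rect.smul, h, Int.toNat_natCast]

/-- The extreme coordinates of a rectangle contained in a centered rectangle. -/
theorem Rect.extreme_coord_bounds {D B : Rect ℓ} (hD : D.IsCentered)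
    (h : B.carrier Γ ⊆ D.carrier Γ) (j : Fin ℓ) :
    -(D.radius j : ℤ) ≤ B.center j - B.radius j ∧ B.center j + B.radius j ≤ D.radius j := by
  have h1 : ((fun j => B.center j + B.radius j, 0) : Vec ℓ Γ) ∈ B.carrier Γ :=
    fun j => by simp
  have h2 : ((fun j => B.center j - B.radius j, 0) : Vec ℓ Γ) ∈ B.carrier Γ :=
    fun j => by simp
  have h3 := (Rect.mem_carrier_of_isCentered hD).1 (h h1) j
  have h4 := (Rect.mem_carrier_of_isCentered hD).1 (h h2) j
  exact ⟨h4.1, h3.2⟩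

variable (Φ : Chart G ℓ Γ)

theorem smul_eq_of_inv_mul_mem_stabilizer {g h : G} {y : X}
    (hgh : g⁻¹ * h ∈ MulAction.stabilizer G y) : h • y = g • y := by
  rw [MulAction.mem_stabilizer_iff, mul_smul, inv_smul_eq_iff] at hgh
  exact hgh

theorem chart_mul_smul {y : X} (hy : y ∈ XH Φ X) {a b : Vec ℓ Γ}
    (ha : a ∈ Φ.D.carrier Γ) (hb : b ∈ Φ.D.carrier Γ)
    (hab : ∀ j, -(Φ.D.radius j : ℤ) + Φ.Z.radius j ≤ a.1 j + b.1 j ∧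
      a.1 j + b.1 j ≤ Φ.D.radius j - Φ.Z.radius j) :
    ∃ z ∈ Φ.Z.carrier Γ, Φ.φ a • Φ.φ b • y = Φ.φ (a + b + z) • y := by
  obtain ⟨z, hz, h⟩ := Φ.mul_mem a ha b hb _ hy (by
    rintro _ ⟨z, hz, rfl⟩
    rw [Rect.mem_carrier_of_isCentered Φ.Z_centered] at hz
    rw [Rect.mem_carrier_of_isCentered Φ.D_centered]
    intro j
    have := hz j; have := hab j
    simp only [Prod.fst_add, Pi.add_apply]
    omega)
  exact ⟨z, hz, by rw [← mul_smul]; exact smul_eq_of_inv_mul_mem_stabilizer h⟩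

theorem chart_mul_inv_smul {y : X} (hy : y ∈ XH Φ X) {a b : Vec ℓ Γ}
    (ha : a ∈ Φ.D.carrier Γ) (hb : b ∈ Φ.D.carrier Γ)
    (hab : ∀ j, -(Φ.D.radius j : ℤ) + Φ.Z.radius j ≤ a.1 j - b.1 j ∧
      a.1 j - b.1 j ≤ Φ.D.radius j - Φ.Z.radius j) :
    ∃ z ∈ Φ.Z.carrier Γ, Φ.φ a • (Φ.φ b)⁻¹ • y = Φ.φ (a - b + z) • y := by
  obtain ⟨z, hz, h⟩ := Φ.mul_inv_mem a ha b hb _ hy (by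
    rintro _ ⟨z, hz, rfl⟩
    rw [Rect.mem_carrier_of_isCentered Φ.Z_centered] at hz
    rw [Rect.mem_carrier_of_isCentered Φ.D_centered]
    intro j
    have := hz j; have := hab j
    simp only [Prod.fst_add, Prod.fst_sub, Pi.add_apply, Pi.sub_apply]
    omega)
  exact ⟨z, hz, by rw [← mul_smul]; exact smul_eq_of_inv_mul_mem_stabilizer h⟩

/-- Change of base point: if `φ(v)·x = φ(b)·y`, then `φ(w)·x` has `y`-coordinate `w - v + b` up to
an error in `𝒵 + 𝒵`. -/
theorem chart_change_base {x y : X} (hy : y ∈ XH Φ X) {v w b : Vec ℓ Γ}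
    (hv : Φ.φ v • x ∈ XH Φ X) (hvb : Φ.φ v • x = Φ.φ b • y)
    (hvD : v ∈ Φ.D.carrier Γ) (hwD : w ∈ Φ.D.carrier Γ) (hbD : b ∈ Φ.D.carrier Γ)
    (hwv : ∀ j, -(Φ.D.radius j : ℤ) + Φ.Z.radius j ≤ w.1 j - v.1 j ∧
      w.1 j - v.1 j ≤ Φ.D.radius j - Φ.Z.radius j)
    (hwvb : ∀ j, -(Φ.D.radius j : ℤ) + 2 * Φ.Z.radius j ≤ w.1 j - v.1 j + b.1 j ∧
      w.1 j - v.1 j + b.1 j ≤ Φ.D.radius j - 2 * Φ.Z.radius j) :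
    ∃ d : Vec ℓ Γ, Φ.φ w • x = Φ.φ d • y ∧ d ∈ Φ.D.carrier Γ ∧
      ∀ j, w.1 j - v.1 j + b.1 j - 2 * Φ.Z.radius j ≤ d.1 j ∧
        d.1 j ≤ w.1 j - v.1 j + b.1 j + 2 * Φ.Z.radius j := by
  obtain ⟨z, hz, h⟩ := chart_mul_inv_smul Φ hv hwD hvD hwv
  rw [inv_smul_smul, hvb] at h
  rw [Rect.mem_carrier_of_isCentered Φ.Z_centered] at hz
  obtain ⟨z', hz', h'⟩ := chart_mul_smul Φ hy (a := w - v + z) (b := b)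
    (by
      rw [Rect.mem_carrier_of_isCentered Φ.D_centered]
      intro j
      have := hz j; have := hwv j
      simp only [Prod.fst_add, Prod.fst_sub, Pi.add_apply, Pi.sub_apply]
      omega) hbD
    (by
      intro j
      have := hz j; have := hwvb j
      simp only [Prod.fst_add, Prod.fst_sub, Pi.add_apply, Pi.sub_apply]
      omega)
  rw [Rect.mem_carrier_of_isCentered Φ.Z_centered] at hz'
  have hd : ∀ j, w.1 j - v.1 j + b.1 j - 2 * Φ.Z.radius j ≤ (w - v + z + b + z').1 j ∧
      (w - v + z + b + z').1 j ≤ w.1 j - v.1 j + b.1 j + 2 * Φ.Z.radius j := by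
    intro j
    have := hz j; have := hz' j
    simp only [Prod.fst_add, Prod.fst_sub, Pi.add_apply, Pi.sub_apply]
    omega
  refine ⟨w - v + z + b + z', h.trans h', ?_, hd⟩
  rw [Rect.mem_carrier_of_isCentered Φ.D_centered]
  intro j
  have := hd j; have := hwvb j
  omega

theorem chart_smul_injOn {y : X} (hy : y ∈ XH Φ X) {a b : Vec ℓ Γ} (ha : a ∈ Φ.D.carrier Γ)
    (hb : b ∈ Φ.D.carrier Γ) (h : Φ.φ a • y = Φ.φ b • y) : a = b := by
  refine Φ.coset_inj a ha b hb _ hy ?_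
  rw [MulAction.mem_stabilizer_iff, mul_smul, h, inv_smul_smul]

/-- The class of a point of `X^ℋ` under a rectangular relation, squeezed between two boxes in the
coordinates of a base point `y`, together with the size estimates for these boxes. -/
theorem exists_box_of_isRectangular {ε q : ℝ} (hℓ : 0 < ℓ) (hε : 0 < ε) (hq1 : 12 * ε < q)
    (hq2 : q < 1 / (24 * (ℓ : ℝ))) {A : Rect ℓ} {F : X → X → Prop}
    (hF : Equivalence F) (hrect : IsRectangular Φ A ε F) {x : X} (hx : x ∈ XH Φ X) :
    ∃ (c r R : Fin ℓ → ℤ) (b : Fin ℓ → ℕ), ∃ y ∈ XH Φ X,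
      (∀ d : Vec ℓ Γ, (∀ j, c j - (r j + 2 * Φ.Z.radius j) ≤ d.1 j ∧
        d.1 j ≤ c j + (r j + 2 * Φ.Z.radius j)) → F x (Φ.φ d • y)) ∧
      (∀ x', F x x' → ∃ d : Vec ℓ Γ, Φ.φ d • y = x' ∧
        ∀ j, c j - (R j - 2 * Φ.Z.radius j) ≤ d.1 j ∧
          d.1 j ≤ c j + (R j - 2 * Φ.Z.radius j)) ∧
      ∀ j, let u : ℤ := (Rect.smul q A).radius j
        (48 * (Φ.Z.radius j : ℤ) ≤ u ∧ 4 * (R j - r j) ≤ u ∧ r j ≤ R j ∧ r j ≤ b j ∧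
          20 * (ℓ * u) ≤ r j ∧ 15 * (ℓ * u) ≤ A.radius j ∧
          15 * (ℓ * u) ≤ (Rect.smul (15 * (ℓ : ℝ) * q) A).radius j) ∧
        A.radius j ≤ b j ∧
        -(Φ.D.radius j : ℤ) ≤ c j - 64 * b j ∧ c j + 64 * b j ≤ Φ.D.radius j := by
  obtain ⟨-, -, -, -, hcls⟩ := hrect
  obtain ⟨δ, B, hδ, ⟨y, -, hδ1, hy, -, hZ, hsub1, hsub2⟩, hAB, hBD, hεA⟩ :=
    hcls x ⟨x, hF.refl x, hx⟩
  refine ⟨B.center, fun j => (Rect.smul (1 - δ) B).radius j - 2 * (Φ.Z.radius j : ℤ),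
    fun j => (Rect.smul (1 + δ) B).radius j + 2 * (Φ.Z.radius j : ℤ), B.radius, y, hy,
    fun d hd => ?_, fun x' hx' => ?_, fun j => ⟨?_, hAB j, ?_⟩⟩
  · refine hsub1 ⟨d, fun j => ?_, rfl⟩
    have := hd j
    dsimp only at this
    rw [abs_le]
    change -_ ≤ d.1 j - B.center j ∧ d.1 j - B.center j ≤ _
    omega
  · obtain ⟨d, hd, rfl⟩ := hsub2 hx'
    refine ⟨d, rfl, fun j => ?_⟩
    have := hd j
    rw [abs_le] at this
    change -_ ≤ d.1 j - B.center j ∧ d.1 j - B.center j ≤ _ at this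
    dsimp only
    omega
  · exact radius_estimates hℓ hε hq1 hq2 hδ hδ1 (Φ.Z_pos j) (hAB j) (hZ j) (hεA j)
  · have h := Rect.extreme_coord_bounds Φ.D_centered hBD j
    have hcast : ((2 : ℝ) ^ (22 * ℓ)) = ((2 ^ (22 * ℓ) : ℕ) : ℝ) := by push_cast; rfl
    rw [hcast, Rect.radius_smul_natCast] at h
    change _ ≤ B.center j - _ ∧ B.center j + _ ≤ _ at h
    have hpow : 2 ^ 6 ≤ 2 ^ (22 * ℓ) := Nat.pow_le_pow_right (by norm_num) (by omega)
    have hmul : 64 * B.radius j ≤ 2 ^ (22 * ℓ) * B.radius j := Nat.mul_le_mul_right _ hpow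
    generalize 2 ^ (22 * ℓ) * B.radius j = t at h hmul
    omega

/-- In the coordinates around a point `x` with a large neighborhood inside `X^ℋ`, the classes of a
rectangular equivalence relation look like large boxes. -/
theorem boxClasses_of_isRectangular {ε q : ℝ} (hℓ : 0 < ℓ) (hε : 0 < ε) (hq1 : 12 * ε < q)
    (hq2 : q < 1 / (24 * (ℓ : ℝ))) {A : Rect ℓ} {F : X → X → Prop}
    (hF : Equivalence F) (hrect : IsRectangular Φ A ε F) {x : X}
    (hXH : ∀ v : Vec ℓ Γ, (∀ j, -(15 * (ℓ * ((Rect.smul q A).radius j : ℤ))) ≤ v.1 j ∧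
      v.1 j ≤ 15 * (ℓ * ((Rect.smul q A).radius j : ℤ))) → Φ.φ v • x ∈ XH Φ X) :
    BoxClasses (Γ := Γ) (fun j => ((Rect.smul q A).radius j : ℤ))
      (fun j => ℓ * ((Rect.smul q A).radius j : ℤ)) (fun v w => F (Φ.φ v • x) (Φ.φ w • x)) := by
  intro v hv
  obtain ⟨c, r, R, b, y, hy, hin, hout, hest⟩ :=
    exists_box_of_isRectangular Φ hℓ hε hq1 hq2 hF hrect (hXH v hv)
  dsimp only at hv hest ⊢
  have hK : ∀ j, ((Rect.smul q A).radius j : ℤ) ≤ ℓ * ((Rect.smul q A).radius j : ℤ) :=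
    fun j => le_mul_of_one_le_left (by positivity) (by exact_mod_cast hℓ)
  obtain ⟨e, he, hec⟩ := hout _ (hF.refl _)
  have hmemD : ∀ w : Vec ℓ Γ, (∀ j, -(15 * (ℓ * ((Rect.smul q A).radius j : ℤ))) ≤ w.1 j ∧
      w.1 j ≤ 15 * (ℓ * ((Rect.smul q A).radius j : ℤ))) → w ∈ Φ.D.carrier Γ := by
    intro w hw
    rw [Rect.mem_carrier_of_isCentered Φ.D_centered]
    intro j
    have := hw j; have := hest j; have := hK j
    omega
  have hboxD : ∀ d : Vec ℓ Γ, (∀ j, c j - (R j - 2 * Φ.Z.radius j) ≤ d.1 j ∧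
      d.1 j ≤ c j + (R j - 2 * Φ.Z.radius j)) → d ∈ Φ.D.carrier Γ := by
    intro d hd
    rw [Rect.mem_carrier_of_isCentered Φ.D_centered]
    intro j
    have := hd j; have := hest j; have := hK j
    omega
  have hbase : ∀ w : Vec ℓ Γ, (∀ j, -(15 * (ℓ * ((Rect.smul q A).radius j : ℤ))) ≤ w.1 j ∧
      w.1 j ≤ 15 * (ℓ * ((Rect.smul q A).radius j : ℤ))) →
      ∃ d : Vec ℓ Γ, Φ.φ w • x = Φ.φ d • y ∧ d ∈ Φ.D.carrier Γ ∧
        ∀ j, w.1 j - v.1 j + e.1 j - 2 * Φ.Z.radius j ≤ d.1 j ∧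
          d.1 j ≤ w.1 j - v.1 j + e.1 j + 2 * Φ.Z.radius j := by
    intro w hw
    refine chart_change_base Φ hy (hXH v hv) he.symm (hmemD v hv) (hmemD w hw) (hboxD e hec)
      (fun j => ?_) (fun j => ?_) <;>
    · have := hw j; have := hv j; have := hec j; have := hest j; have := hK j
      omega
  refine ⟨fun j => c j - e.1 j + v.1 j, r, R, fun j => ⟨(hest j).1.2.1, (hest j).1.2.2.1,
    (hest j).1.2.2.2.2.1⟩, fun w hw hwr => ?_, fun w hw hvw j => ?_⟩
  · obtain ⟨d, hd, -, hdw⟩ := hbase w hw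
    rw [hd]
    refine hin d fun j => ?_
    have := hdw j; have := hwr j
    dsimp only at this
    omega
  · obtain ⟨d, hd, hdD, hdw⟩ := hbase w hw
    obtain ⟨d', hd', hdc⟩ := hout _ hvw
    have : d' = d := chart_smul_injOn Φ hy (hboxD d' hdc) hdD (hd'.trans hd)
    subst this
    have := hdw j; have := hdc j
    dsimp only
    omega

/-- If no translate of `x` lies near a boundary, opposite faces around `x` are linked by `E`. -/
theorem facesLinked_of_forall_notMem_bdry {Q : Rect ℓ} (hQ : Q.IsCentered) (hℓ : 0 < ℓ)
    {E : X → X → Prop} (hE : Equivalence E) {x : X} (hx : x ∈ XH Φ X)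
    (hXH : ∀ v : Vec ℓ Γ, (∀ j, -(15 * (ℓ * (Q.radius j : ℤ))) ≤ v.1 j ∧
      v.1 j ≤ 15 * (ℓ * (Q.radius j : ℤ))) → Φ.φ v • x ∈ XH Φ X)
    (hZQ : ∀ j, Φ.Z.radius j ≤ Q.radius j)
    (hQD : ∀ j, 15 * (ℓ * (Q.radius j : ℤ)) ≤ Φ.D.radius j)
    (hbd : ∀ i, x ∉ chartImgSet Φ ((Rect.smul ((30 * ℓ : ℕ) : ℝ) Q).carrier Γ) (bdry Φ E Q i)) :
    FacesLinked (Γ := Γ) (fun j => (Q.radius j : ℤ)) (fun j => ℓ * (Q.radius j : ℤ))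
      (fun j => (Φ.Z.radius j : ℤ)) (fun v w => E (Φ.φ v • x) (Φ.φ w • x)) := by
  intro y hy i
  dsimp only at hy ⊢
  have hc : Q.center = 0 := hQ
  have hK : ∀ j, (Q.radius j : ℤ) ≤ ℓ * (Q.radius j : ℤ) :=
    fun j => le_mul_of_one_le_left (by positivity) (by exact_mod_cast hℓ)
  have hyX : Φ.φ y • x ∈ XH Φ X := hXH y fun j => by have := hy j; have := hK j; omega
  have hyD : y ∈ Φ.D.carrier Γ := by
    rw [Rect.mem_carrier_of_isCentered Φ.D_centered]
    intro j
    have := hy j; have := hQD j; have := hK j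
    omega
  have h0D : (0 : Vec ℓ Γ) ∈ Φ.D.carrier Γ := by
    rw [Rect.mem_carrier_of_isCentered Φ.D_centered]
    intro j
    simp
  have hnot : Φ.φ y • x ∉ bdry Φ E Q i := by
    intro hmem
    obtain ⟨z, hz, h⟩ := chart_mul_inv_smul Φ hyX h0D hyD (fun j => by
      have := hy j; have := hZQ j; have := hQD j; have := hK j
      simp only [Prod.fst_zero, Pi.zero_apply]
      omega)
    rw [inv_smul_smul, Φ.φ_zero, one_smul] at h
    rw [Rect.mem_carrier_of_isCentered Φ.Z_centered] at hz
    refine hbd i (Set.mem_biUnion hmem ⟨0 - y + z, ?_, h.symm⟩)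
    rw [Rect.mem_carrier_of_isCentered (show (Rect.smul _ Q).IsCentered from hQ)]
    intro j
    have := hz j; have := hy j; have := hZQ j; have := hK j
    rw [Rect.radius_smul_natCast]
    push_cast
    rw [mul_assoc]
    simp only [Prod.fst_add, Prod.fst_sub, Prod.fst_zero, Pi.add_apply, Pi.sub_apply, Pi.zero_apply]
    omega
  have hface : ∀ s : ℤ, s = 1 ∨ s = -1 → ∀ p ∈ chartImg Φ ((Q.faceRect i s).carrier Γ) (Φ.φ y • x),
      ∃ w : Vec ℓ Γ, p = Φ.φ w • x ∧
        (∀ j, y.1 j - (Q.radius j + Φ.Z.radius j) ≤ w.1 j ∧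
          w.1 j ≤ y.1 j + (Q.radius j + Φ.Z.radius j)) ∧
        y.1 i + s * Q.radius i - Φ.Z.radius i ≤ w.1 i ∧
        w.1 i ≤ y.1 i + s * Q.radius i + Φ.Z.radius i := by
    rintro s hs _ ⟨a, ha, rfl⟩
    have hai : a.1 i = s * Q.radius i := by
      have := ha i
      simpa [Rect.faceRect, hc, sub_eq_zero] using this
    have haj : ∀ j, -(Q.radius j : ℤ) ≤ a.1 j ∧ a.1 j ≤ Q.radius j := by
      intro j
      rcases eq_or_ne j i with rfl | hj
      · rw [hai]
        rcases hs with rfl | rfl <;> omega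
      · have := ha j
        simpa [Rect.faceRect, hc, hj, abs_le] using this
    obtain ⟨z, hz, h⟩ := chart_mul_smul Φ hx (a := a) (b := y)
      (by
        rw [Rect.mem_carrier_of_isCentered Φ.D_centered]
        intro j
        have := haj j; have := hQD j; have := hK j
        omega) hyD
      (fun j => by
        have := haj j; have := hy j; have := hZQ j; have := hQD j; have := hK j
        omega)
    rw [Rect.mem_carrier_of_isCentered Φ.Z_centered] at hz
    refine ⟨a + y + z, h, fun j => ?_, ?_⟩
    · have := haj j; have := hz j
      simp only [Prod.fst_add, Pi.add_apply]
      omega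
    · have := hz i
      simp only [Prod.fst_add, Pi.add_apply, hai]
      omega
  obtain ⟨t, ⟨p, hp, hpt⟩, p', hp', hpt'⟩ :=
    Set.not_disjoint_iff.1 fun hdisj => hnot ⟨hyX, hdisj⟩
  obtain ⟨w, rfl, hw, hwi⟩ := hface (-1) (Or.inr rfl) p hp
  obtain ⟨w', rfl, hw', hwi'⟩ := hface 1 (Or.inl rfl) p' hp'
  exact ⟨w, w', hE.trans hpt (hE.symm hpt'), hw, hw', by omega, by omega⟩

end ChartLemmas

/-- **Lemma 5.4 (points far from all boundaries have large neighborhoods in their class).**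
Let `G` act on `X`, let `Φ` be a chart for `G`, let `ε > 0`, let `q` satisfy
`12ε < q < 1/(24ℓ)`, and let `A` be a centered rectangle. Suppose `E` is a
`(Φ, A, ε)`-sub-rectangular equivalence relation on `X`. If `x ∈ X^ℋ` satisfies
`φ(15ℓq·A)·x ⊆ X^ℋ` and `φ(3·𝒵)·x ⊄ [x]_E`, then there is `1 ≤ i ≤ ℓ` with
`x ∈ φ(30ℓ·(q·A))·∂_i^Φ(E, q·A)`. -/
theorem near_boundary {G X : Type*} [Group G] [Countable G] [MulAction G X]
    {ℓ : ℕ} {Γ : Type*} [AddCommGroup Γ] (Φ : Chart G ℓ Γ)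
    (ε q : ℝ) (hε : 0 < ε) (hq1 : 12 * ε < q) (hq2 : q < 1 / (24 * (ℓ : ℝ)))
    (A : Rect ℓ) (hA : A.IsCentered)
    (E : X → X → Prop) (hE : Equivalence E)
    (hsub : IsSubRectangular Φ A ε E)
    (x : X) (hx : x ∈ XH Φ X)
    (hnbhd : chartImg Φ ((Rect.smul (15 * (ℓ : ℝ) * q) A).carrier Γ) x ⊆ XH Φ X)
    (hnot : ¬ chartImg Φ ((Rect.smul 3 Φ.Z).carrier Γ) x ⊆ eqClass E x) :
    ∃ i : Fin ℓ,
      x ∈ chartImgSet Φ ((Rect.smul ((30 * ℓ : ℕ) : ℝ) (Rect.smul q A)).carrier Γ)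
        (bdry Φ E (Rect.smul q A) i) := by
  have hℓ : 0 < ℓ := by
    rcases Nat.eq_zero_or_pos ℓ with rfl | h
    · norm_num at hq2
      linarith
    · exact h
  obtain ⟨F, hF, hFE, hrect⟩ := hsub
  obtain ⟨c, r, R, b, -, -, -, -, hest⟩ :=
    exists_box_of_isRectangular Φ hℓ hε hq1 hq2 hF hrect hx
  dsimp only at hest
  have hXH : ∀ v : Vec ℓ Γ, (∀ j, -(15 * (ℓ * ((Rect.smul q A).radius j : ℤ))) ≤ v.1 j ∧
      v.1 j ≤ 15 * (ℓ * ((Rect.smul q A).radius j : ℤ))) → Φ.φ v • x ∈ XH Φ X := by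
    intro v hv
    refine hnbhd ⟨v, ?_, rfl⟩
    rw [Rect.mem_carrier_of_isCentered (show (Rect.smul _ A).IsCentered from hA)]
    intro j
    have := hv j; have := hest j
    omega
  by_contra! hbd
  refine hnot ?_
  rintro _ ⟨t, ht, rfl⟩
  rw [Rect.mem_carrier_of_isCentered (show (Rect.smul _ Φ.Z).IsCentered from Φ.Z_centered)] at ht
  have h := related_of_facesLinked
    (E := fun v w : Vec ℓ Γ => E (Φ.φ v • x) (Φ.φ w • x))
    (F := fun v w : Vec ℓ Γ => F (Φ.φ v • x) (Φ.φ w • x))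
    (ζ := fun j => (Φ.Z.radius j : ℤ))
    ⟨fun _ => hE.refl _, fun h => hE.symm h, fun h h' => hE.trans h h'⟩
    ⟨fun _ => hF.refl _, fun h => hF.symm h, fun h h' => hF.trans h h'⟩
    (fun _ _ => hFE _ _)
    (fun j => by have := hest j; have := Φ.Z_pos j; omega) (fun _ => rfl)
    (fun j => by have := hest j; omega)
    (boxClasses_of_isRectangular Φ hℓ hε hq1 hq2 hF hrect hXH)
    (facesLinked_of_forall_notMem_bdry Φ (Q := Rect.smul q A) hA hℓ hE hx hXH
      (fun j => by have := hest j; omega) (fun j => by have := hest j; omega) hbd)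
    t (fun j => by
      have h1 := ht j
      have h2 := Rect.radius_smul_natCast 3 Φ.Z j
      rw [Nat.cast_ofNat] at h2
      rw [h2] at h1
      have := hest j
      omega)
  rwa [Φ.φ_zero, one_smul] at h
end

section
/- Let a countable group G act on a set X, let Φ = (ℓ, φ, 𝒵, Γ, ℋ) be a chart for G, let 0 < ε < 1/16, let q satisfy 6ε < q < 1/2, and let A ⊆ ℤ^ℓ × Γ be a centered rectangle. Suppose E is a (Φ, A, ε)-sub-rectangular equivalence relation on X. Let x ∈ X^ℋ and 1 ≤ i ≤ ℓ. If y_1, y_2, …, y_t ∈ ∂_i^Φ(E, q·A) ∩ φ(2^{17ℓ}·A)·x satisfy φ(2^{19ℓ}·Aⁱ + 5q·A)·y_r ∩ φ(2^{19ℓ}·Aⁱ + 5q·A)·y_s = ∅ for all r ≠ s, then t ≤ 2^{22ℓ²}. -/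
open Pointwise

namespace Chart

variable {G X : Type*} [Group G] [MulAction G X] {ℓ : ℕ} {Γ : Type*} [AddCommGroup Γ]

theorem mem_D_iff_s14 (Φ : Chart G ℓ Γ) (v : Vec ℓ Γ) :
    v ∈ Φ.D.carrier Γ ↔ ∀ j, |v.1 j| ≤ (Φ.D.radius j : ℤ) := by
  have h : Φ.D.center = 0 := Φ.D_centered
  simp [Rect.carrier, h]

theorem mem_Z_iff_s14 (Φ : Chart G ℓ Γ) (v : Vec ℓ Γ) :
    v ∈ Φ.Z.carrier Γ ↔ ∀ j, |v.1 j| ≤ (Φ.Z.radius j : ℤ) := by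
  have h : Φ.Z.center = 0 := Φ.Z_centered
  simp [Rect.carrier, h]

theorem add_Z_subset_D (Φ : Chart G ℓ Γ) (v : Vec ℓ Γ)
    (h : ∀ j, |v.1 j| + (Φ.Z.radius j : ℤ) ≤ Φ.D.radius j) :
    (fun z => v + z) '' Φ.Z.carrier Γ ⊆ Φ.D.carrier Γ := by
  rintro _ ⟨z, hz, rfl⟩
  rw [mem_Z_iff_s14] at hz
  rw [mem_D_iff_s14]
  intro j
  exact (abs_add_le _ _).trans ((add_le_add_right (hz j) _).trans (h j))

theorem smul_smul_eq (Φ : Chart G ℓ Γ) {x : X} (hx : x ∈ XH Φ X) {r s : Vec ℓ Γ}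
    (hr : r ∈ Φ.D.carrier Γ) (hs : s ∈ Φ.D.carrier Γ)
    (h : ∀ j, |(r + s).1 j| + (Φ.Z.radius j : ℤ) ≤ Φ.D.radius j) :
    ∃ z : Vec ℓ Γ, (∀ j, |z.1 j| ≤ (Φ.Z.radius j : ℤ)) ∧
      Φ.φ r • Φ.φ s • x = Φ.φ (r + s + z) • x := by
  obtain ⟨z, hz, hm⟩ := Φ.mul_mem r hr s hs _ hx (Φ.add_Z_subset_D _ h)
  refine ⟨z, (Φ.mem_Z_iff_s14 z).1 hz, ?_⟩
  rw [MulAction.mem_stabilizer_iff, mul_smul, inv_smul_eq_iff, mul_smul] at hm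
  exact hm

theorem smul_eq_smul_smul (Φ : Chart G ℓ Γ) {x y : X} (hy : y ∈ XH Φ X) {r s : Vec ℓ Γ}
    (hr : r ∈ Φ.D.carrier Γ) (hs : s ∈ Φ.D.carrier Γ) (hxy : y = Φ.φ s • x)
    (h : ∀ j, |(r - s).1 j| + (Φ.Z.radius j : ℤ) ≤ Φ.D.radius j) :
    ∃ z : Vec ℓ Γ, (∀ j, |z.1 j| ≤ (Φ.Z.radius j : ℤ)) ∧
      Φ.φ r • x = Φ.φ (r - s + z) • y := by
  obtain ⟨z, hz, hm⟩ := Φ.mul_inv_mem r hr s hs _ hy (Φ.add_Z_subset_D _ h)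
  refine ⟨z, (Φ.mem_Z_iff_s14 z).1 hz, ?_⟩
  rw [MulAction.mem_stabilizer_iff, mul_smul, inv_smul_eq_iff, mul_smul] at hm
  rw [← hm, hxy, inv_smul_smul]

theorem eq_of_smul_eq (Φ : Chart G ℓ Γ) {x : X} (hx : x ∈ XH Φ X) {r s : Vec ℓ Γ}
    (hr : r ∈ Φ.D.carrier Γ) (hs : s ∈ Φ.D.carrier Γ) (h : Φ.φ r • x = Φ.φ s • x) : r = s := by
  refine Φ.coset_inj r hr s hs _ hx ?_
  rw [MulAction.mem_stabilizer_iff, mul_smul, h, inv_smul_smul]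

/-- Integer form of the statement that `U` is a class of a `(Φ, A, ε)`-rectangular equivalence
relation: in the coordinates based at `base`, the set `U` lies between the boxes of radii `inner`
and `outer` around `center`. -/
structure Frame (Φ : Chart G ℓ Γ) (A : Rect ℓ) (ε : ℝ) (U : Set X) where
  base : X
  center : Fin ℓ → ℤ
  inner : Fin ℓ → ℤ
  outer : Fin ℓ → ℤ
  size : Fin ℓ → ℤ
  base_mem : base ∈ XH Φ X
  inner_mem : ∀ v : Vec ℓ Γ, (∀ j, |v.1 j - center j| ≤ inner j) → Φ.φ v • base ∈ U
  exists_outer : ∀ y ∈ U, ∃ v : Vec ℓ Γ,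
    (∀ j, |v.1 j - center j| ≤ outer j) ∧ y = Φ.φ v • base
  radius_le_size : ∀ j, (A.radius j : ℤ) ≤ size j
  outer_le : ∀ j, outer j ≤ inner j + ⌊ε * A.radius j⌋ + 1
  two_outer_le : ∀ j, 2 * outer j ≤ 2 * size j + ⌊ε * A.radius j⌋
  le_two_inner : ∀ j, 2 * size j ≤ 2 * inner j + ⌊ε * A.radius j⌋ + 2
  four_Z_le : ∀ j, 4 * (Φ.Z.radius j : ℤ) ≤ ⌊ε * A.radius j⌋
  size_le_D : ∀ j, |center j| + 2 ^ (22 * ℓ) * size j ≤ Φ.D.radius j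

theorem nonempty_frame (Φ : Chart G ℓ Γ) (A : Rect ℓ) (ε : ℝ) (hε0 : 0 < ε)
    {F : X → X → Prop} (hF : Equivalence F) (hrect : IsRectangular Φ A ε F) {y : X}
    (hy : y ∈ XH Φ X) : Nonempty (Frame Φ A ε (eqClass F y)) := by
  obtain ⟨-, -, -, -, h⟩ := hrect
  obtain ⟨δ, B, hδ, ⟨z, -, hδ1, hz, -, hZ, hin, hout⟩, hAB, hD, hBA⟩ :=
    h y ⟨y, hF.refl y, hy⟩
  have key : ∀ j, 0 ≤ ⌊δ * (B.radius j : ℝ)⌋ ∧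
      2 * (Φ.Z.radius j : ℤ) ≤ ⌊δ * (B.radius j : ℝ)⌋ ∧
      2 * ⌊δ * (B.radius j : ℝ)⌋ ≤ ⌊ε * (A.radius j : ℝ)⌋ := by
    intro j
    have h0 : 0 ≤ ⌊δ * (B.radius j : ℝ)⌋ := Int.floor_nonneg.2 (by positivity)
    have h0' : 0 ≤ ⌊2 * δ * (B.radius j : ℝ)⌋ := Int.floor_nonneg.2 (by positivity)
    have h1' : 0 ≤ ⌊ε * (A.radius j : ℝ)⌋ := Int.floor_nonneg.2 (by positivity)
    have h1 := hZ j
    have h2 := hBA j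
    simp only [Rect.smul] at h1 h2
    have h3 : ⌊(2 : ℝ) * (Φ.Z.radius j : ℝ)⌋ = 2 * (Φ.Z.radius j : ℤ) := by
      rw [Int.floor_eq_iff]; push_cast; constructor <;> linarith
    rw [h3] at h1
    have h4 : 2 * ⌊δ * (B.radius j : ℝ)⌋ ≤ ⌊2 * δ * (B.radius j : ℝ)⌋ := by
      rw [Int.le_floor]; push_cast
      linarith [Int.floor_le (δ * (B.radius j : ℝ))]
    omega
  have hfloor : ∀ j, ⌊(1 + δ) * (B.radius j : ℝ)⌋ = B.radius j + ⌊δ * (B.radius j : ℝ)⌋ := by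
    intro j
    rw [add_mul, one_mul, add_comm, Int.floor_add_natCast, add_comm]
  have hinner : ∀ j, (B.radius j : ℤ) - ⌊δ * (B.radius j : ℝ)⌋ - 1 ≤
      ⌊(1 - δ) * (B.radius j : ℝ)⌋ := by
    intro j
    rw [Int.le_floor]; push_cast
    linarith [Int.lt_floor_add_one (δ * (B.radius j : ℝ))]
  have hinner0 : ∀ j, 0 ≤ ⌊(1 - δ) * (B.radius j : ℝ)⌋ := fun j =>
    Int.floor_nonneg.2 (mul_nonneg (by linarith) (by positivity))
  -- the carrier of `2 ^ (22 * ℓ) · B` lies in the domain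
  have hpow : ∀ j, ⌊(2 : ℝ) ^ (22 * ℓ) * (B.radius j : ℝ)⌋ = 2 ^ (22 * ℓ) * (B.radius j : ℤ) := by
    intro j
    exact_mod_cast Int.floor_natCast (R := ℝ) (2 ^ (22 * ℓ) * B.radius j)
  have hcorner : ∀ σ : ℤ, |σ| ≤ 1 → ∀ j,
      |B.center j + σ * (2 ^ (22 * ℓ) * (B.radius j : ℤ))| ≤ Φ.D.radius j := by
    intro σ hσ
    refine (Φ.mem_D_iff_s14 (fun j => B.center j + σ * (2 ^ (22 * ℓ) * (B.radius j : ℤ)), 0)).1 (hD ?_)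
    intro j
    have h0 : (0 : ℤ) ≤ 2 ^ (22 * ℓ) * (B.radius j : ℤ) := by positivity
    simp only [Rect.smul, hpow, add_sub_cancel_left, Int.toNat_of_nonneg h0, abs_mul σ,
      abs_of_nonneg h0]
    nlinarith
  refine ⟨⟨z, B.center, fun j => ⌊(1 - δ) * (B.radius j : ℝ)⌋,
    fun j => ⌊(1 + δ) * (B.radius j : ℝ)⌋, fun j => B.radius j, hz, ?_, ?_, ?_, ?_, ?_, ?_, ?_, ?_⟩⟩
  · intro v hv
    refine hin ⟨v, fun j => ?_, rfl⟩
    simpa [Rect.smul, Int.toNat_of_nonneg (hinner0 j)] using hv j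
  · intro w hw
    obtain ⟨v, hv, rfl⟩ := hout hw
    refine ⟨v, fun j => ?_, rfl⟩
    have hj := hv j
    have := hfloor j
    have := key j
    simp only [Rect.smul] at hj
    omega
  · intro j
    exact_mod_cast hAB j
  · intro j
    have := hfloor j
    have := hinner j
    have := key j
    omega
  · intro j
    have := hfloor j
    have := key j
    omega
  · intro j
    have := hinner j
    have := key j
    omega
  · intro j
    have := key j
    omega
  · intro j
    have h1 := hcorner 1 (by norm_num) j
    have h2 := hcorner (-1) (by norm_num) j
    rw [abs_le] at h1 h2
    rcases abs_cases (B.center j) with h | h <;> linarith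

namespace Frame

variable {Φ : Chart G ℓ Γ} {A : Rect ℓ} {ε : ℝ} {U : Set X}

theorem inner_mem_smul (f : Frame Φ A ε U) {w u : Vec ℓ Γ}
    (hw : ∀ j, |w.1 j| ≤ 2 * (A.radius j : ℤ))
    (hwu : ∀ j, |w.1 j + (u.1 j - f.center j)| + Φ.Z.radius j ≤ f.inner j)
    (hu : ∀ j, |u.1 j - f.center j| ≤ f.outer j)
    (hℓ : 0 < ℓ) (hε : ∀ j, 16 * ⌊ε * A.radius j⌋ ≤ A.radius j) :
    Φ.φ w • Φ.φ u • f.base ∈ U := by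
  have hN : (4 : ℤ) ≤ 2 ^ (22 * ℓ) := by
    calc (4 : ℤ) = 2 ^ 2 := by norm_num
      _ ≤ 2 ^ (22 * ℓ) := pow_le_pow_right₀ (by norm_num) (by omega)
  have hD : ∀ j, |f.center j| + 4 * f.size j ≤ Φ.D.radius j := fun j => by
    have := f.size_le_D j
    have := f.radius_le_size j
    nlinarith
  have hbound : ∀ j, |w.1 j| ≤ (Φ.D.radius j : ℤ) ∧ |u.1 j| ≤ (Φ.D.radius j : ℤ) ∧
      |(w + u).1 j| + (Φ.Z.radius j : ℤ) ≤ Φ.D.radius j := fun j => by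
    have h1 := hw j
    have h3 := hu j
    have h4 := abs_le.1 (le_sub_iff_add_le.2 (hD j))
    have h5 := f.radius_le_size j
    have h6 := f.two_outer_le j
    have h7 := hε j
    have h8 := f.four_Z_le j
    rw [← le_sub_iff_add_le, abs_le, abs_le, abs_le]
    rw [abs_le] at h1 h3
    simp only [Prod.fst_add, Pi.add_apply]
    omega
  obtain ⟨z, hz, h⟩ := Φ.smul_smul_eq f.base_mem
    ((Φ.mem_D_iff_s14 w).2 fun j => (hbound j).1) ((Φ.mem_D_iff_s14 u).2 fun j => (hbound j).2.1)
    fun j => (hbound j).2.2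
  rw [h]
  refine f.inner_mem _ fun j => ?_
  have h1 := abs_le.1 (hz j)
  have h2 := abs_le.1 (le_sub_iff_add_le.2 (hwu j))
  simp only [Prod.fst_add, Pi.add_apply]
  rw [abs_le]
  omega

/-- A boundary point of a class with a frame is close to one of the two faces. -/
theorem lt_abs_of_mem_bdry (f : Frame Φ A ε U) {q : ℝ} {E : X → X → Prop} {i : Fin ℓ} {y : X}
    (hA : A.IsCentered) (hE : Equivalence E)
    (hU : ∀ w ∈ U, E y w) (hy : y ∈ bdry Φ E (Rect.smul q A) i)
    (hε : ∀ j, 16 * ⌊ε * A.radius j⌋ ≤ A.radius j)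
    (hq : ∀ j, 6 * ⌊ε * A.radius j⌋ ≤ ⌊q * A.radius j⌋)
    (hq' : ∀ j, 2 * ⌊q * A.radius j⌋ ≤ A.radius j)
    {u : Vec ℓ Γ} (hu : ∀ j, |u.1 j - f.center j| ≤ f.outer j) (hyu : y = Φ.φ u • f.base) :
    f.inner i < |u.1 i - f.center i| + ⌊q * A.radius i⌋ + Φ.Z.radius i := by
  by_contra! hcon
  have hℓ : 0 < ℓ := i.pos
  have hA0 : A.center = 0 := hA
  have hpoint : ∀ σ : ℤ, (σ = 1 ∨ σ = -1) →
      y ∈ eSat E (chartImg Φ (((Rect.smul q A).faceRect i σ).carrier Γ) y) := by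
    intro σ hσ
    set w : Vec ℓ Γ := (fun j => if j = i then σ * ⌊q * A.radius i⌋ else
      if 0 < u.1 j - f.center j then -(⌊ε * A.radius j⌋ + 1 + Φ.Z.radius j)
      else ⌊ε * A.radius j⌋ + 1 + Φ.Z.radius j, 0) with hwdef
    have hwi : w.1 i = σ * ⌊q * A.radius i⌋ := by simp [hwdef]
    have hwj : ∀ j, j ≠ i → w.1 j = if 0 < u.1 j - f.center j then
        -(⌊ε * A.radius j⌋ + 1 + Φ.Z.radius j) else ⌊ε * A.radius j⌋ + 1 + Φ.Z.radius j := by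
      intro j hj; simp [hwdef, hj]
    clear_value w
    refine ⟨Φ.φ w • y, ⟨w, fun j => ?_, rfl⟩, hE.symm (hU _ ?_)⟩
    · by_cases hj : j = i
      · subst hj
        have := hq j
        have := f.four_Z_le j
        simp only [Rect.faceRect, Rect.smul, hA0, Function.update_self, hwi]
        rw [Int.toNat_of_nonneg (by omega)]
        simp
      · have h1 := hq j
        have h2 := f.four_Z_le j
        have h3 := Φ.Z_pos j
        simp only [Rect.faceRect, Rect.smul, hA0, Function.update_of_ne hj, hwj j hj]
        rw [Int.toNat_of_nonneg (by omega), abs_le]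
        simp only [Pi.zero_apply]
        split_ifs <;> omega
    · rw [hyu]
      refine f.inner_mem_smul (fun j => ?_) (fun j => ?_) hu hℓ hε
      all_goals
        have h1 := hq j
        have h2 := f.four_Z_le j
        have h3 := Φ.Z_pos j
        have h4 := hq' j
        have h5 := hε j
        have h6 := hu j
        have h7 := f.outer_le j
        have h8 := f.le_two_inner j
        have h9 := f.radius_le_size j
        rw [abs_le] at h6
        first | rw [← le_sub_iff_add_le, abs_le] | rw [abs_le]
        by_cases hj : j = i
        · subst hj
          rw [hwi]
          have h10 := abs_le.1 (show |u.1 j - f.center j| ≤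
            f.inner j - ⌊q * A.radius j⌋ - Φ.Z.radius j by linarith)
          rcases hσ with rfl | rfl <;> omega
        · rw [hwj j hj]
          split_ifs <;> omega
  exact Set.disjoint_left.1 hy.2 (hpoint (-1) (Or.inr rfl)) (hpoint 1 (Or.inl rfl))

/-- Two points of a class whose frame coordinates are close in direction `i` differ by a group
element whose coordinate vector is small in direction `i`. -/
theorem exists_smul_eq_of_close (f : Frame Φ A ε U) {i : Fin ℓ} {x y y' : X} {d : ℤ}
    (hε : ∀ j, 16 * ⌊ε * A.radius j⌋ ≤ A.radius j)
    (hy : y ∈ XH Φ X)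
    {u u' : Vec ℓ Γ} (hu : ∀ j, |u.1 j - f.center j| ≤ f.outer j) (hyu : y = Φ.φ u • f.base)
    (hu' : ∀ j, |u'.1 j - f.center j| ≤ f.outer j) (hyu' : y' = Φ.φ u' • f.base)
    {v v' : Vec ℓ Γ} (hv : ∀ j, |v.1 j| ≤ 2 ^ (17 * ℓ) * (A.radius j : ℤ))
    (hyv : y = Φ.φ v • x)
    (hv' : ∀ j, |v'.1 j| ≤ 2 ^ (17 * ℓ) * (A.radius j : ℤ)) (hyv' : y' = Φ.φ v' • x)
    (hd : |u'.1 i - u.1 i| ≤ d) :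
    ∃ w : Vec ℓ Γ, y' = Φ.φ w • y ∧ (∀ j, |w.1 j| ≤ 2 ^ (19 * ℓ) * (A.radius j : ℤ)) ∧
      |w.1 i| ≤ d + Φ.Z.radius i := by
  have hℓ : 0 < ℓ := i.pos
  have hT : (1 : ℤ) ≤ 2 ^ (17 * ℓ) := one_le_pow₀ (by norm_num)
  have hT19 : 4 * (2 : ℤ) ^ (17 * ℓ) ≤ 2 ^ (19 * ℓ) := by
    calc 4 * (2 : ℤ) ^ (17 * ℓ) = 2 ^ (17 * ℓ + 2) := by ring
      _ ≤ 2 ^ (19 * ℓ) := pow_le_pow_right₀ (by norm_num) (by omega)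
  have hT22 : 8 * (2 : ℤ) ^ (17 * ℓ) ≤ 2 ^ (22 * ℓ) := by
    calc 8 * (2 : ℤ) ^ (17 * ℓ) = 2 ^ (17 * ℓ + 3) := by ring
      _ ≤ 2 ^ (22 * ℓ) := pow_le_pow_right₀ (by norm_num) (by omega)
  generalize (2 : ℤ) ^ (17 * ℓ) = T at *
  have hD : ∀ j, |f.center j| + 8 * f.size j ≤ Φ.D.radius j := fun j => by
    have := f.size_le_D j
    have := f.radius_le_size j
    nlinarith
  have hDT : ∀ j, 4 * (T * (A.radius j : ℤ)) ≤ Φ.D.radius j := fun j => by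
    have h1 := f.size_le_D j
    have h2 := f.radius_le_size j
    have h3 := abs_nonneg (f.center j)
    have h4 : (0 : ℤ) ≤ A.radius j := by positivity
    nlinarith [mul_le_mul hT22 h2 h4 (by positivity), mul_nonneg (by linarith : 0 ≤ T) h4]
  have hTA : ∀ j, (A.radius j : ℤ) ≤ T * A.radius j := fun j =>
    le_mul_of_one_le_left (by positivity) hT
  have hZA : ∀ j, 64 * (Φ.Z.radius j : ℤ) ≤ A.radius j := fun j => by
    have := f.four_Z_le j
    have := hε j
    omega
  obtain ⟨z, hz, h⟩ := Φ.smul_eq_smul_smul hy (r := v') (s := v) (x := x)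
    ((Φ.mem_D_iff_s14 _).2 fun j => by linarith [hv' j, hDT j, abs_nonneg (v'.1 j)])
    ((Φ.mem_D_iff_s14 _).2 fun j => by linarith [hv j, hDT j, abs_nonneg (v.1 j)]) hyv fun j => by
      have h1 := abs_sub (v'.1 j) (v.1 j)
      have := hZA j
      have := hTA j
      simp only [Prod.fst_sub, Pi.sub_apply]
      linarith [hv j, hv' j, hDT j]
  have hmem : ∀ p : Vec ℓ Γ, (∀ j, |p.1 j - f.center j| ≤ f.outer j) → p ∈ Φ.D.carrier Γ := by
    intro p hp
    refine (Φ.mem_D_iff_s14 _).2 fun j => ?_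
    have h1 := hp j
    have h4 := abs_le.1 (le_sub_iff_add_le.2 (hD j))
    have h5 := f.radius_le_size j
    have h6 := f.two_outer_le j
    have h7 := hε j
    rw [abs_le] at *
    omega
  have hsub : ∀ j, |u'.1 j - u.1 j| ≤ 5 * f.size j := fun j => by
    have h1 := hu j
    have h2 := hu' j
    have h5 := f.radius_le_size j
    have h6 := f.two_outer_le j
    have h7 := hε j
    rw [abs_le] at *
    omega
  obtain ⟨z', hz', h'⟩ := Φ.smul_eq_smul_smul hy (r := u') (s := u) (x := f.base)
    (hmem u' hu') (hmem u hu) hyu fun j => by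
      have := hZA j
      have := hsub j
      simp only [Prod.fst_sub, Pi.sub_apply]
      linarith [hD j, abs_nonneg (f.center j), f.radius_le_size j]
  have hle : ∀ j, |(v' - v + z).1 j| ≤ 3 * (T * A.radius j) := fun j => by
    have h1 := abs_sub (v'.1 j) (v.1 j)
    have h2 := abs_add_le (v'.1 j - v.1 j) (z.1 j)
    have := hZA j
    have := hTA j
    simp only [Prod.fst_sub, Pi.sub_apply, Prod.fst_add, Pi.add_apply]
    linarith [hv j, hv' j, hz j]
  have heq : v' - v + z = u' - u + z' := by
    refine Φ.eq_of_smul_eq hy ((Φ.mem_D_iff_s14 _).2 fun j => ?_) ((Φ.mem_D_iff_s14 _).2 fun j => ?_)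
      (by rw [← h, ← h', ← hyv', ← hyu'])
    · linarith [hle j, hDT j, abs_nonneg ((v' - v + z).1 j)]
    · have h2 := abs_add_le (u'.1 j - u.1 j) (z'.1 j)
      have := hZA j
      simp only [Prod.fst_sub, Pi.sub_apply, Prod.fst_add, Pi.add_apply]
      linarith [hsub j, hz' j, hD j, abs_nonneg (f.center j), f.radius_le_size j]
  refine ⟨v' - v + z, by rw [hyv', h], fun j => ?_, ?_⟩
  · have h4 : (0 : ℤ) ≤ A.radius j := by positivity
    nlinarith [hle j]
  · rw [heq]
    simp only [Prod.fst_sub, Pi.sub_apply, Prod.fst_add, Pi.add_apply]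
    exact (abs_add_le _ _).trans (add_le_add hd (hz' i))

end Frame

/-- Within a single class, boundary points fall into two kinds (near the upper face or near the
lower face), and two points of the same kind differ little in direction `i`. -/
theorem Frame.exists_side {Φ : Chart G ℓ Γ} {A : Rect ℓ} {ε q : ℝ} {U : Set X}
    (f : Frame Φ A ε U) {E : X → X → Prop} (hE : Equivalence E) (hA : A.IsCentered)
    (hU : ∀ y ∈ U, ∀ w ∈ U, E y w) (i : Fin ℓ) (x : X)
    (hε : ∀ j, 16 * ⌊ε * A.radius j⌋ ≤ A.radius j)
    (hq : ∀ j, 6 * ⌊ε * A.radius j⌋ ≤ ⌊q * A.radius j⌋)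
    (hq' : ∀ j, 2 * ⌊q * A.radius j⌋ ≤ A.radius j) :
    ∃ side : X → Prop, ∀ y ∈ U, ∀ y' ∈ U, (side y ↔ side y') →
      y ∈ bdry Φ E (Rect.smul q A) i → y' ∈ bdry Φ E (Rect.smul q A) i →
      ∀ v v' : Vec ℓ Γ, (∀ j, |v.1 j| ≤ 2 ^ (17 * ℓ) * (A.radius j : ℤ)) → y = Φ.φ v • x →
        (∀ j, |v'.1 j| ≤ 2 ^ (17 * ℓ) * (A.radius j : ℤ)) → y' = Φ.φ v' • x →
        ∃ w : Vec ℓ Γ, y' = Φ.φ w • y ∧ (∀ j, |w.1 j| ≤ 2 ^ (19 * ℓ) * (A.radius j : ℤ)) ∧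
          |w.1 i| ≤ 5 * ⌊q * A.radius i⌋ := by
  choose! u hu hyu using f.exists_outer
  refine ⟨fun y => 0 ≤ (u y).1 i - f.center i, ?_⟩
  intro y hy y' hy' hside hb hb' v v' hv hyv hv' hyv'
  have h1 := f.lt_abs_of_mem_bdry hA hE (hU y hy) hb hε hq hq' (hu y hy) (hyu y hy)
  have h2 := f.lt_abs_of_mem_bdry hA hE (hU y' hy') hb' hε hq hq' (hu y' hy') (hyu y' hy')
  have h3 := hu y hy i
  have h4 := hu y' hy' i
  have h5 := f.outer_le i
  have h6 := f.four_Z_le i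
  have h7 := hq i
  have h8 := Φ.Z_pos i
  obtain ⟨w, hw, hw1, hw2⟩ := f.exists_smul_eq_of_close (i := i) hε hb.1 (hu y hy) (hyu y hy)
    (hu y' hy') (hyu y' hy') hv hyv hv' hyv'
    (d := ⌊q * A.radius i⌋ + ⌊ε * A.radius i⌋ + 1 + Φ.Z.radius i) (by
      rw [abs_le]
      by_cases h : 0 ≤ (u y).1 i - f.center i
      · have h' := hside.1 h
        rw [abs_of_nonneg h] at h1 h3
        rw [abs_of_nonneg h'] at h2 h4
        omega
      · have h' := fun t => h (hside.2 t)
        rw [abs_of_nonpos (by omega)] at h1 h3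
        rw [abs_of_nonpos (by omega)] at h2 h4
        omega)
  exact ⟨w, hw, hw1, by omega⟩

/-- The point of the grid with spacings `⌊a_j / 2⌋` having the given indices. -/
def gridPoint (Γ : Type*) [AddCommGroup Γ] (A : Rect ℓ) (k : Fin ℓ → ℤ) : Vec ℓ Γ :=
  (fun j => ((A.radius j : ℤ) / 2) * k j, 0)

/-- Every interval of the form `[c - p - s, c - p]` or `[c + p, c + p + s]` meets `s ℤ`. -/
theorem exists_mul_near (s p c : ℤ) (hs : 0 < s) :
    (∃ k, -p - s ≤ s * k - c ∧ s * k - c ≤ -p) ∧ (∃ k, p ≤ s * k - c ∧ s * k - c ≤ p + s) := by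
  refine ⟨⟨(c - p) / s, ?_, ?_⟩, ⟨(c + p + s) / s, ?_, ?_⟩⟩
  · have := Int.emod_add_mul_ediv (c - p) s
    have := Int.emod_lt_of_pos (c - p) hs
    linarith
  · have := Int.emod_add_mul_ediv (c - p) s
    have := Int.emod_nonneg (c - p) hs.ne'
    linarith
  · have := Int.emod_add_mul_ediv (c + p + s) s
    have := Int.emod_lt_of_pos (c + p + s) hs
    linarith
  · have := Int.emod_add_mul_ediv (c + p + s) s
    have := Int.emod_nonneg (c + p + s) hs.ne'
    linarith

/-- Every class meeting `φ(2 ^ (17 ℓ) · A) · x` contains a grid point with small indices. -/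
theorem Frame.exists_gridPoint_mem {Φ : Chart G ℓ Γ} {A : Rect ℓ} {ε : ℝ} {U : Set X}
    (f : Frame Φ A ε U) (hℓ : 0 < ℓ)
    (hε : ∀ j, 16 * ⌊ε * A.radius j⌋ ≤ A.radius j) {x y : X} (hy : y ∈ XH Φ X) (hyU : y ∈ U)
    {v : Vec ℓ Γ} (hv : ∀ j, |v.1 j| ≤ 2 ^ (17 * ℓ) * (A.radius j : ℤ))
    (hyv : y = Φ.φ v • x) :
    ∃ k : Fin ℓ → ℤ, (∀ j, |k j| ≤ 4 * 2 ^ (17 * ℓ)) ∧ Φ.φ (gridPoint Γ A k) • x ∈ U := by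
  have hT : (1 : ℤ) ≤ 2 ^ (17 * ℓ) := one_le_pow₀ (by norm_num)
  have hT22 : 8 * (2 : ℤ) ^ (17 * ℓ) ≤ 2 ^ (22 * ℓ) := by
    calc 8 * (2 : ℤ) ^ (17 * ℓ) = 2 ^ (17 * ℓ + 3) := by ring
      _ ≤ 2 ^ (22 * ℓ) := pow_le_pow_right₀ (by norm_num) (by omega)
  generalize (2 : ℤ) ^ (17 * ℓ) = T at *
  have hDT : ∀ j, 8 * (T * (A.radius j : ℤ)) ≤ Φ.D.radius j := fun j => by
    have h1 := f.size_le_D j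
    have h2 := f.radius_le_size j
    have h3 := abs_nonneg (f.center j)
    have h4 : (0 : ℤ) ≤ A.radius j := by positivity
    nlinarith [mul_le_mul hT22 h2 h4 (by positivity)]
  have hTA : ∀ j, (A.radius j : ℤ) ≤ T * A.radius j := fun j =>
    le_mul_of_one_le_left (by positivity) hT
  obtain ⟨u, hu, hyu⟩ := f.exists_outer y hyU
  have hk : ∀ j, ∃ k : ℤ,
      |((A.radius j : ℤ) / 2) * k - v.1 j| ≤ A.radius j - Φ.Z.radius j ∧
      |((A.radius j : ℤ) / 2) * k - v.1 j + (u.1 j - f.center j)| + 2 * Φ.Z.radius j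
        ≤ f.inner j := by
    intro j
    have h2 := f.four_Z_le j
    have h3 := Φ.Z_pos j
    have h5 := hε j
    have h6 := hu j
    have h7 := f.outer_le j
    have h8 := f.le_two_inner j
    have h9 := f.radius_le_size j
    obtain ⟨⟨k₁, hk₁, hk₁'⟩, ⟨k₂, hk₂, hk₂'⟩⟩ := exists_mul_near ((A.radius j : ℤ) / 2)
      (⌊ε * A.radius j⌋ + 1 + 2 * Φ.Z.radius j) (v.1 j) (by omega)
    rw [abs_le] at h6
    rcases le_total 0 (u.1 j - f.center j) with h | h
    · refine ⟨k₁, ?_, ?_⟩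
      · rw [abs_le]; omega
      · rw [← le_sub_iff_add_le, abs_le]; omega
    · refine ⟨k₂, ?_, ?_⟩
      · rw [abs_le]; omega
      · rw [← le_sub_iff_add_le, abs_le]; omega
  choose k hk1 hk2 using hk
  have hg : ∀ j, |((A.radius j : ℤ) / 2) * k j| ≤ T * A.radius j + A.radius j := fun j => by
    have h1 := hk1 j
    have h2 := hv j
    have := abs_add_le (((A.radius j : ℤ) / 2) * k j - v.1 j) (v.1 j)
    rw [sub_add_cancel] at this
    linarith [Int.natCast_nonneg (Φ.Z.radius j)]
  refine ⟨k, fun j => ?_, ?_⟩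
  · have h1 := hg j
    have h2 := f.four_Z_le j
    have h3 := Φ.Z_pos j
    have h5 := hε j
    have hs : 2 ≤ (A.radius j : ℤ) / 2 := by omega
    have hs' : (A.radius j : ℤ) ≤ 2 * ((A.radius j : ℤ) / 2) + 1 := by omega
    generalize (A.radius j : ℤ) / 2 = s at *
    rw [abs_mul, abs_of_nonneg (by linarith)] at h1
    by_contra! hcon
    nlinarith
  · obtain ⟨z, hz, h⟩ := Φ.smul_eq_smul_smul hy (r := gridPoint Γ A k) (s := v) (x := x)
      ((Φ.mem_D_iff_s14 _).2 fun j => by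
        simp only [gridPoint]
        linarith [hg j, hDT j, hTA j, abs_nonneg (v.1 j), hv j])
      ((Φ.mem_D_iff_s14 _).2 fun j => by linarith [hv j, hDT j, abs_nonneg (v.1 j)]) hyv fun j => by
        simp only [gridPoint, Prod.fst_sub, Pi.sub_apply]
        linarith [hk1 j, hDT j, hTA j, Int.natCast_nonneg (A.radius j)]
    rw [h, hyu]
    refine f.inner_mem_smul (fun j => ?_) (fun j => ?_) hu hℓ hε
    · simp only [gridPoint, Prod.fst_sub, Pi.sub_apply, Prod.fst_add, Pi.add_apply]
      linarith [hk1 j, hz j, abs_add_le ((A.radius j : ℤ) / 2 * k j - v.1 j) (z.1 j),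
        Int.natCast_nonneg (A.radius j)]
    · simp only [gridPoint, Prod.fst_sub, Pi.sub_apply, Prod.fst_add, Pi.add_apply]
      have h1 := hk2 j
      have h2 := hz j
      rw [← le_sub_iff_add_le, abs_le] at *
      omega

end Chart

/-- **Lemma 5.5 (counting separated boundary points).**
Let `G` act on `X`, let `Φ` be a chart for `G`, let `0 < ε < 1/16`, let `q` satisfy
`6ε < q < 1/2`, and let `A` be a centered rectangle. Suppose `E` is a
`(Φ, A, ε)`-sub-rectangular equivalence relation on `X`. Let `x ∈ X^ℋ` and `1 ≤ i ≤ ℓ`.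
If `y_1, …, y_t ∈ ∂_i^Φ(E, q·A) ∩ φ(2^{17ℓ}·A)·x` satisfy
`φ(2^{19ℓ}·Aⁱ + 5q·A)·y_r ∩ φ(2^{19ℓ}·Aⁱ + 5q·A)·y_s = ∅` for all `r ≠ s`,
then `t ≤ 2^{22ℓ²}`. -/
theorem bdry_count {G X : Type*} [Group G] [Countable G] [MulAction G X]
    {ℓ : ℕ} {Γ : Type*} [AddCommGroup Γ] (Φ : Chart G ℓ Γ)
    (ε q : ℝ) (hε0 : 0 < ε) (hε : ε < 1 / 16) (hq1 : 6 * ε < q) (hq2 : q < 1 / 2)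
    (A : Rect ℓ) (hA : A.IsCentered)
    (E : X → X → Prop) (hE : Equivalence E)
    (hsub : IsSubRectangular Φ A ε E)
    (x : X) (hx : x ∈ XH Φ X) (i : Fin ℓ)
    (t : ℕ) (y : Fin t → X)
    (hy : ∀ r, y r ∈ bdry Φ E (Rect.smul q A) i ∩
      chartImg Φ ((Rect.smul ((2 : ℝ) ^ (17 * ℓ)) A).carrier Γ) x)
    (hdisj : ∀ r s, r ≠ s →
      chartImg Φ ((Rect.smul ((2 : ℝ) ^ (19 * ℓ)) (A.face i)).carrier Γ +
          (Rect.smul (5 * q) A).carrier Γ) (y r) ∩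
      chartImg Φ ((Rect.smul ((2 : ℝ) ^ (19 * ℓ)) (A.face i)).carrier Γ +
          (Rect.smul (5 * q) A).carrier Γ) (y s) = ∅) :
    t ≤ 2 ^ (22 * ℓ ^ 2) := by
  obtain ⟨F, hF, hFE, hrect⟩ := hsub
  have hℓ : 0 < ℓ := i.pos
  have hA0 : A.center = 0 := hA
  have hε' : ∀ j, 16 * ⌊ε * (A.radius j : ℝ)⌋ ≤ A.radius j := fun j => by
    have h1 := Int.floor_le (ε * (A.radius j : ℝ))
    have h2 : (0 : ℝ) ≤ A.radius j := by positivity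
    have h3 : (16 : ℝ) * ⌊ε * (A.radius j : ℝ)⌋ ≤ A.radius j := by nlinarith
    exact_mod_cast h3
  have hq : ∀ j, 6 * ⌊ε * (A.radius j : ℝ)⌋ ≤ ⌊q * (A.radius j : ℝ)⌋ := fun j => by
    have h1 := Int.floor_le (ε * (A.radius j : ℝ))
    have h2 : (0 : ℝ) ≤ A.radius j := by positivity
    rw [Int.le_floor]; push_cast
    nlinarith
  have hq' : ∀ j, 2 * ⌊q * (A.radius j : ℝ)⌋ ≤ A.radius j := fun j => by
    have h1 := Int.floor_le (q * (A.radius j : ℝ))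
    have h2 : (0 : ℝ) ≤ A.radius j := by positivity
    have h3 : (2 : ℝ) * ⌊q * (A.radius j : ℝ)⌋ ≤ A.radius j := by nlinarith
    exact_mod_cast h3
  have hpow : ∀ n a : ℕ, ⌊(2 : ℝ) ^ n * (a : ℝ)⌋ = 2 ^ n * (a : ℤ) := fun n a => by
    exact_mod_cast Int.floor_natCast (R := ℝ) (2 ^ n * a)
  have hframe : ∀ r, Nonempty (Chart.Frame Φ A ε (eqClass F (y r))) := fun r =>
    Φ.nonempty_frame A ε hε0 hF hrect (hy r).1.1
  have hclass : ∀ p w, F p w → eqClass F p = eqClass F w := fun p w h =>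
    Set.ext fun _ => ⟨hF.trans (hF.symm h), hF.trans h⟩
  -- a choice of side for every class
  have hside : ∀ U : Set X, ∃ side : X → Prop, ∀ r s, eqClass F (y r) = U → eqClass F (y s) = U →
      (side (y r) ↔ side (y s)) → ∃ w : Vec ℓ Γ, y s = Φ.φ w • y r ∧
        (∀ j, |w.1 j| ≤ 2 ^ (19 * ℓ) * (A.radius j : ℤ)) ∧
        |w.1 i| ≤ 5 * ⌊q * (A.radius i : ℝ)⌋ := by
    intro U
    by_cases hU : ∃ r, eqClass F (y r) = U
    · obtain ⟨r₀, rfl⟩ := hU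
      obtain ⟨f⟩ := hframe r₀
      obtain ⟨side, h⟩ := f.exists_side hE hA
        (fun p hp w hw => hFE _ _ (hF.trans (hF.symm hp) hw)) i x hε' hq hq'
      refine ⟨side, fun r s hr hs hrs => ?_⟩
      obtain ⟨v, hv, hvy⟩ := (hy r).2
      obtain ⟨v', hv', hvy'⟩ := (hy s).2
      refine h _ (hr ▸ hF.refl _) _ (hs ▸ hF.refl _) hrs (hy r).1 (hy s).1 v v' ?_ hvy.symm ?_
        hvy'.symm
      · intro j
        have h0 : (0 : ℤ) ≤ 2 ^ (17 * ℓ) * (A.radius j : ℤ) := by positivity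
        simpa [Rect.smul, hA0, hpow, Int.toNat_of_nonneg h0] using hv j
      · intro j
        have h0 : (0 : ℤ) ≤ 2 ^ (17 * ℓ) * (A.radius j : ℤ) := by positivity
        simpa [Rect.smul, hA0, hpow, Int.toNat_of_nonneg h0] using hv' j
    · exact ⟨fun _ => True, fun r _ hr => absurd ⟨r, hr⟩ hU⟩
  choose side hside using hside
  have hgrid : ∀ r, ∃ k : Fin ℓ → ℤ, (∀ j, |k j| ≤ 4 * 2 ^ (17 * ℓ)) ∧
      F (y r) (Φ.φ (Chart.gridPoint Γ A k) • x) := by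
    intro r
    obtain ⟨f⟩ := hframe r
    obtain ⟨v, hv, hvy⟩ := (hy r).2
    refine f.exists_gridPoint_mem hℓ hε' (hy r).1.1 (hF.refl _) (v := v) (fun j => ?_) hvy.symm
    have h0 : (0 : ℤ) ≤ 2 ^ (17 * ℓ) * (A.radius j : ℤ) := by positivity
    simpa [Rect.smul, hA0, hpow, Int.toNat_of_nonneg h0] using hv j
  choose k hk hkF using hgrid
  have hpow4 : (2 : ℤ) ^ (17 * ℓ + 4) = 16 * 2 ^ (17 * ℓ) := by ring
  have hpos : (0 : ℤ) < 2 ^ (17 * ℓ) := by positivity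
  have hlt : ∀ r j, (k r j + 4 * 2 ^ (17 * ℓ)).toNat < 2 ^ (17 * ℓ + 4) := fun r j => by
    have h := abs_le.1 (hk r j)
    zify
    rw [Int.toNat_of_nonneg (by linarith), hpow4]
    linarith
  have hinj : Function.Injective (fun r : Fin t =>
      ((fun j => ⟨(k r j + 4 * 2 ^ (17 * ℓ)).toNat, hlt r j⟩, side (eqClass F (y r)) (y r)) :
        (Fin ℓ → Fin (2 ^ (17 * ℓ + 4))) × Prop)) := by
    intro r s hrs
    by_contra hne
    obtain ⟨h1, h2⟩ := Prod.mk.inj hrs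
    have hks : k r = k s := by
      funext j
      have h := congrArg Fin.val (congrFun h1 j)
      have hr := abs_le.1 (hk r j)
      have hs := abs_le.1 (hk s j)
      simp only at h
      omega
    have hcl : eqClass F (y s) = eqClass F (y r) := by
      rw [hclass _ _ (hkF s), hclass _ _ (hkF r), hks]
    rw [hcl] at h2
    obtain ⟨w, hw, hw1, hw2⟩ := hside _ r s rfl hcl (iff_of_eq h2)
    have hm : 5 * ⌊q * (A.radius i : ℝ)⌋ ≤ ⌊5 * q * (A.radius i : ℝ)⌋ := by
      rw [Int.le_floor]; push_cast
      linarith [Int.floor_le (q * (A.radius i : ℝ))]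
    have hzero : ∀ c : ℝ, ∀ B : Rect ℓ, B.center = 0 → (0 : Vec ℓ Γ) ∈ (Rect.smul c B).carrier Γ :=
      fun c B hB j => by simp [Rect.smul, hB]
    have hmem : y s ∈ chartImg Φ ((Rect.smul ((2 : ℝ) ^ (19 * ℓ)) (A.face i)).carrier Γ +
        (Rect.smul (5 * q) A).carrier Γ) (y r) ∩
      chartImg Φ ((Rect.smul ((2 : ℝ) ^ (19 * ℓ)) (A.face i)).carrier Γ +
        (Rect.smul (5 * q) A).carrier Γ) (y s) := by
      refine ⟨⟨w, Set.mem_add.2 ⟨(Function.update w.1 i 0, 0), fun j => ?_,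
        (Pi.single i (w.1 i), w.2), fun j => ?_, ?_⟩, hw.symm⟩,
        ⟨0, Set.mem_add.2 ⟨0, hzero _ _ hA0, 0, hzero _ _ hA0, add_zero 0⟩, ?_⟩⟩
      · by_cases hj : j = i
        · subst hj
          simp [Rect.smul, Rect.face, hA0]
        · have h0 : (0 : ℤ) ≤ 2 ^ (19 * ℓ) * (A.radius j : ℤ) := by positivity
          simpa [Rect.smul, Rect.face, hA0, hj, hpow, Int.toNat_of_nonneg h0] using hw1 j
      · by_cases hj : j = i
        · subst hj
          simp only [Rect.smul, hA0, Pi.single_eq_same, Pi.zero_apply, sub_zero]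
          omega
        · simp [Rect.smul, hA0, hj]
      · ext j
        · by_cases hj : j = i
          · subst hj; simp
          · simp [hj]
        · simp
      · simp [Φ.φ_zero]
    rw [hdisj r s hne] at hmem
    exact hmem
  have hcard := Fintype.card_le_of_injective _ hinj
  simp only [Fintype.card_fin, Fintype.card_prod, Fintype.card_fun, Fintype.card_prop] at hcard
  calc t ≤ (2 ^ (17 * ℓ + 4)) ^ ℓ * 2 := hcard
    _ = 2 ^ ((17 * ℓ + 4) * ℓ + 1) := by rw [← pow_mul, pow_succ]
    _ ≤ 2 ^ (22 * ℓ ^ 2) := Nat.pow_le_pow_right (by norm_num) (by nlinarith)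
end
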